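/- arXiv:1404.4638 — 2 statements merged into one kernel-verified Lean document; each statement's English description precedes it below -/
import Mathlib

section
/- Fix B > 0 and set b* = (1/5)(−1 + √(1 + 5π²/(4B²))). Let 0 < b ≤ b*, let u be a classical solution with decay weight b of the Zakharov–Kuznetsov–Burgers problem on the strip S, and assume ‖u₀‖ ≤ 3π/(8B). Then for every t ≥ 0: ∫_S e^{2bx} u(x,y,t)² dx dy ≤ e^{−χ t} ∫_S e^{2bx} u₀(x,y)² dx dy, where χ = b π²/(4B²); in particular, for b = b* the decay rate is χ = (π²/(20B²))(−1 + √(1 + 5π²/(4B²))). -/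
open MeasureTheory Real Set

/-- The mixed partial derivative `∂_x^i ∂_y^j ∂_t^k u` of a function
`u = u(x, y, t)`, evaluated at `(x, y, t)`. -/
noncomputable def pd (i j k : ℕ) (u : ℝ → ℝ → ℝ → ℝ) (x y t : ℝ) : ℝ :=
  iteratedDeriv i (fun x' => iteratedDeriv j (fun y' => iteratedDeriv k (u x' y') t) y) x

/-- The strip `S = ℝ × (0, B)`. -/
def strip (B : ℝ) : Set (ℝ × ℝ) := Set.univ ×ˢ Set.Ioo 0 B

/-- A classical solution, with decay weight `b`, of the Zakharov–Kuznetsov–Burgers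
initial-boundary value problem on the strip `S = ℝ × (0, B)`:
a smooth function `u(x, y, t)` satisfying the ZKB equation
`u_t - u_xx + u u_x + u_xxx + u_xyy = 0` in `ℝ × (0,B) × (0,∞)`, the Dirichlet
boundary conditions `u(x,0,t) = u(x,B,t) = 0`, and such that for every partial
derivative `∂^α u` of order `|α| ≤ 5` in `x, y, t`, both `|∂^α u|²` and
`e^{2bx} |∂^α u|²` are integrable over `S` for each `t ≥ 0`, with integrals
bounded uniformly for `t` in compact subsets of `[0, ∞)`, and
`(1 + e^{2bx}) |∂^α u(x,y,t)|² → 0` as `|x| → ∞`, uniformly in `y` and locally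
uniformly in `t`. -/
structure IsZKBSolution (B b : ℝ) (u : ℝ → ℝ → ℝ → ℝ) : Prop where
  smooth : ContDiff ℝ (⊤ : ℕ∞) (fun p : ℝ × ℝ × ℝ => u p.1 p.2.1 p.2.2)
  pde : ∀ x : ℝ, ∀ y ∈ Set.Ioo (0:ℝ) B, ∀ t : ℝ, 0 < t →
    pd 0 0 1 u x y t - pd 2 0 0 u x y t + u x y t * pd 1 0 0 u x y t
      + pd 3 0 0 u x y t + pd 1 2 0 u x y t = 0
  bdry0 : ∀ x t : ℝ, 0 ≤ t → u x 0 t = 0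
  bdryB : ∀ x t : ℝ, 0 ≤ t → u x B t = 0
  integ : ∀ i j k : ℕ, i + j + k ≤ 5 → ∀ t : ℝ, 0 ≤ t →
    IntegrableOn (fun p : ℝ × ℝ => (1 + Real.exp (2*b*p.1)) * (pd i j k u p.1 p.2 t)^2)
      (strip B) volume
  bdd : ∀ i j k : ℕ, i + j + k ≤ 5 → ∀ T : ℝ, ∃ M : ℝ, ∀ t ∈ Set.Icc (0:ℝ) T,
    (∫ p in strip B, (1 + Real.exp (2*b*p.1)) * (pd i j k u p.1 p.2 t)^2) ≤ M
  decay : ∀ i j k : ℕ, i + j + k ≤ 5 → ∀ T : ℝ, ∀ ε : ℝ, 0 < ε → ∃ R : ℝ,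
    ∀ x : ℝ, R ≤ |x| → ∀ y ∈ Set.Icc (0:ℝ) B, ∀ t ∈ Set.Icc (0:ℝ) T,
      (1 + Real.exp (2*b*x)) * (pd i j k u x y t)^2 ≤ ε

/-! ### Partial derivatives of smooth functions -/

section PartialDerivatives

variable {f : ℝ × ℝ × ℝ → ℝ}

lemma hasDerivAt_slice_x {n : WithTop ℕ∞} (hf : ContDiff ℝ n f) (hn : n ≠ 0) (x y t : ℝ) :
    HasDerivAt (fun x' => f (x', y, t)) (fderiv ℝ f (x, y, t) (1, 0, 0)) x :=
  ((hf.differentiable hn) (x, y, t)).hasFDerivAt.comp_hasDerivAt x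
    ((hasDerivAt_id x).prodMk ((hasDerivAt_const x y).prodMk (hasDerivAt_const x t)))

lemma hasDerivAt_slice_y {n : WithTop ℕ∞} (hf : ContDiff ℝ n f) (hn : n ≠ 0) (x y t : ℝ) :
    HasDerivAt (fun y' => f (x, y', t)) (fderiv ℝ f (x, y, t) (0, 1, 0)) y :=
  ((hf.differentiable hn) (x, y, t)).hasFDerivAt.comp_hasDerivAt y
    ((hasDerivAt_const y x).prodMk ((hasDerivAt_id y).prodMk (hasDerivAt_const y t)))

lemma hasDerivAt_slice_t {n : WithTop ℕ∞} (hf : ContDiff ℝ n f) (hn : n ≠ 0) (x y t : ℝ) :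
    HasDerivAt (fun t' => f (x, y, t')) (fderiv ℝ f (x, y, t) (0, 0, 1)) t :=
  ((hf.differentiable hn) (x, y, t)).hasFDerivAt.comp_hasDerivAt t
    ((hasDerivAt_const t x).prodMk ((hasDerivAt_const t y).prodMk (hasDerivAt_id t)))

lemma contDiff_fderiv_apply (hf : ContDiff ℝ (⊤ : ℕ∞) f) (v : ℝ × ℝ × ℝ) :
    ContDiff ℝ (⊤ : ℕ∞) (fun p => fderiv ℝ f p v) :=
  (hf.fderiv_right (m := (⊤ : ℕ∞)) (by simp)).clm_apply contDiff_const

lemma fderiv_fderiv_apply_comm (hf : ContDiff ℝ (⊤ : ℕ∞) f) (p v w : ℝ × ℝ × ℝ) :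
    fderiv ℝ (fun q => fderiv ℝ f q v) p w = fderiv ℝ (fun q => fderiv ℝ f q w) p v := by
  have hd : DifferentiableAt ℝ (fderiv ℝ f) p :=
    ((hf.fderiv_right (m := (⊤ : ℕ∞)) (by simp)).differentiable (by simp)) p
  have key : ∀ a c : ℝ × ℝ × ℝ,
      fderiv ℝ (fun q => fderiv ℝ f q a) p c = fderiv ℝ (fderiv ℝ f) p c a := by
    intro a c
    rw [fderiv_clm_apply hd (differentiableAt_const a)]
    simp
  rw [key, key]
  refine (hf.contDiffAt.isSymmSndFDerivAt ?_).eq w v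
  rw [minSmoothness_of_isRCLikeNormedField]
  exact WithTop.coe_le_coe.2 le_top

variable {u : ℝ → ℝ → ℝ → ℝ}

lemma contDiff_pd (hu : ContDiff ℝ (⊤ : ℕ∞) (fun p : ℝ × ℝ × ℝ => u p.1 p.2.1 p.2.2))
    (i j k : ℕ) :
    ContDiff ℝ (⊤ : ℕ∞) (fun p : ℝ × ℝ × ℝ => pd i j k u p.1 p.2.1 p.2.2) := by
  have ht : ∀ k : ℕ, ContDiff ℝ (⊤ : ℕ∞)
      (fun p : ℝ × ℝ × ℝ => iteratedDeriv k (u p.1 p.2.1) p.2.2) := by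
    intro k
    induction k with
    | zero => simpa using hu
    | succ k ih =>
      convert contDiff_fderiv_apply ih (0, 0, 1) using 2 with p
      rw [iteratedDeriv_succ]
      exact (hasDerivAt_slice_t ih (by simp) p.1 p.2.1 p.2.2).deriv
  have hy : ∀ j : ℕ, ContDiff ℝ (⊤ : ℕ∞) (fun p : ℝ × ℝ × ℝ =>
      iteratedDeriv j (fun y' => iteratedDeriv k (u p.1 y') p.2.2) p.2.1) := by
    intro j
    induction j with
    | zero => simpa using ht k
    | succ j ih =>
      convert contDiff_fderiv_apply ih (0, 1, 0) using 2 with p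
      rw [iteratedDeriv_succ]
      exact (hasDerivAt_slice_y ih (by simp) p.1 p.2.1 p.2.2).deriv
  unfold pd
  induction i with
  | zero => simpa using hy j
  | succ i ih =>
    convert contDiff_fderiv_apply ih (1, 0, 0) using 2 with p
    rw [iteratedDeriv_succ]
    exact (hasDerivAt_slice_x ih (by simp) p.1 p.2.1 p.2.2).deriv

lemma pd_zero (u : ℝ → ℝ → ℝ → ℝ) (x y t : ℝ) : pd 0 0 0 u x y t = u x y t := by
  simp [pd]

lemma hasDerivAt_pd_x (hu : ContDiff ℝ (⊤ : ℕ∞) (fun p : ℝ × ℝ × ℝ => u p.1 p.2.1 p.2.2))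
    (i j k : ℕ) (x y t : ℝ) :
    HasDerivAt (fun x' => pd i j k u x' y t) (pd (i + 1) j k u x y t) x := by
  have h := hasDerivAt_slice_x (contDiff_pd hu i j k) (by simp) x y t
  have e : pd (i + 1) j k u x y t = deriv (fun x' => pd i j k u x' y t) x := by
    simp only [pd, iteratedDeriv_succ]
  rw [e]
  exact h.differentiableAt.hasDerivAt

lemma hasDerivAt_pd_y (hu : ContDiff ℝ (⊤ : ℕ∞) (fun p : ℝ × ℝ × ℝ => u p.1 p.2.1 p.2.2))
    (j k : ℕ) (x y t : ℝ) :
    HasDerivAt (fun y' => pd 0 j k u x y' t) (pd 0 (j + 1) k u x y t) y := by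
  have h := hasDerivAt_slice_y (contDiff_pd hu 0 j k) (by simp) x y t
  have e : pd 0 (j + 1) k u x y t = deriv (fun y' => pd 0 j k u x y' t) y := by
    simp only [pd, iteratedDeriv_succ, iteratedDeriv_zero]
  rw [e]
  exact h.differentiableAt.hasDerivAt

lemma hasDerivAt_pd_t (hu : ContDiff ℝ (⊤ : ℕ∞) (fun p : ℝ × ℝ × ℝ => u p.1 p.2.1 p.2.2))
    (k : ℕ) (x y t : ℝ) :
    HasDerivAt (fun t' => pd 0 0 k u x y t') (pd 0 0 (k + 1) u x y t) t := by
  have h := hasDerivAt_slice_t (contDiff_pd hu 0 0 k) (by simp) x y t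
  have e : pd 0 0 (k + 1) u x y t = deriv (fun t' => pd 0 0 k u x y t') t := by
    simp only [pd, iteratedDeriv_succ, iteratedDeriv_zero]
  rw [e]
  exact h.differentiableAt.hasDerivAt

lemma hasDerivAt_pd_one_y
    (hu : ContDiff ℝ (⊤ : ℕ∞) (fun p : ℝ × ℝ × ℝ => u p.1 p.2.1 p.2.2))
    (j k : ℕ) (x y t : ℝ) :
    HasDerivAt (fun y' => pd 1 j k u x y' t) (pd 1 (j + 1) k u x y t) y := by
  have hg := contDiff_pd hu 0 j k
  have hx : ∀ p : ℝ × ℝ × ℝ, pd 1 j k u p.1 p.2.1 p.2.2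
      = fderiv ℝ (fun q : ℝ × ℝ × ℝ => pd 0 j k u q.1 q.2.1 q.2.2) p (1, 0, 0) := fun p =>
    (hasDerivAt_pd_x hu 0 j k p.1 p.2.1 p.2.2).unique
      (hasDerivAt_slice_x hg (by simp) p.1 p.2.1 p.2.2)
  have hy : ∀ p : ℝ × ℝ × ℝ, pd 0 (j + 1) k u p.1 p.2.1 p.2.2
      = fderiv ℝ (fun q : ℝ × ℝ × ℝ => pd 0 j k u q.1 q.2.1 q.2.2) p (0, 1, 0) := fun p =>
    (hasDerivAt_pd_y hu j k p.1 p.2.1 p.2.2).unique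
      (hasDerivAt_slice_y hg (by simp) p.1 p.2.1 p.2.2)
  have h1 := hasDerivAt_slice_y (contDiff_fderiv_apply hg (1, 0, 0)) (by simp) x y t
  rw [fderiv_fderiv_apply_comm hg] at h1
  have h2 := hasDerivAt_pd_x hu 0 (j + 1) k x y t
  have h3 := hasDerivAt_slice_x (contDiff_fderiv_apply hg (0, 1, 0)) (by simp) x y t
  have e2 : (fun x' => pd 0 (j + 1) k u x' y t) = fun x' =>
      fderiv ℝ (fun q : ℝ × ℝ × ℝ => pd 0 j k u q.1 q.2.1 q.2.2) (x', y, t) (0, 1, 0) :=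
    funext fun x' => hy (x', y, t)
  have e1 : (fun y' => pd 1 j k u x y' t) = fun y' =>
      fderiv ℝ (fun q : ℝ × ℝ × ℝ => pd 0 j k u q.1 q.2.1 q.2.2) (x, y', t) (1, 0, 0) :=
    funext fun y' => hx (x, y', t)
  rw [e2] at h2
  rw [e1, show pd 1 (j + 1) k u x y t = _ from h2.unique h3]
  exact h1

end PartialDerivatives

/-! ### One-dimensional sup bounds and integral inequalities -/

lemma le_half_integral_abs_deriv {g g' : ℝ → ℝ} (hg : ∀ x, HasDerivAt g (g' x) x)
    (hi : Integrable g') (hbot : Filter.Tendsto g Filter.atBot (nhds 0))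
    (htop : Filter.Tendsto g Filter.atTop (nhds 0)) (x : ℝ) :
    |g x| ≤ 1 / 2 * ∫ s, |g' s| := by
  have h1 := integral_Iic_of_hasDerivAt_of_tendsto' (a := x) (fun s _ => hg s)
    hi.integrableOn hbot
  have h2 := integral_Ioi_of_hasDerivAt_of_tendsto' (a := x) (fun s _ => hg s)
    hi.integrableOn htop
  have h3 := integral_add_compl (measurableSet_Iic (a := x)) hi.abs
  rw [compl_Iic] at h3
  have h4 := abs_integral_le_integral_abs (μ := volume.restrict (Iic x)) (f := g')
  have h5 := abs_integral_le_integral_abs (μ := volume.restrict (Ioi x)) (f := g')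
  rw [h1, sub_zero] at h4
  rw [h2, zero_sub, abs_neg] at h5
  linarith

lemma le_half_setIntegral_abs_deriv {B : ℝ} {g g' : ℝ → ℝ}
    (hg : ∀ y, HasDerivAt g (g' y) y) (hc : Continuous g') (h0 : g 0 = 0) (hB : g B = 0)
    {y : ℝ} (hy : y ∈ Ioo 0 B) :
    |g y| ≤ 1 / 2 * ∫ s in Ioo 0 B, |g' s| := by
  have hi : ∀ a c : ℝ, IntervalIntegrable g' volume a c := fun a c => hc.intervalIntegrable a c
  have h1 := intervalIntegral.integral_eq_sub_of_hasDerivAt (fun s _ => hg s) (hi 0 y)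
  have h2 := intervalIntegral.integral_eq_sub_of_hasDerivAt (fun s _ => hg s) (hi y B)
  have h3 := intervalIntegral.integral_add_adjacent_intervals (hi 0 y).abs (hi y B).abs
  have h4 := intervalIntegral.abs_integral_le_integral_abs (μ := volume) (f := g') hy.1.le
  have h5 := intervalIntegral.abs_integral_le_integral_abs (μ := volume) (f := g') hy.2.le
  rw [h1, h0, sub_zero] at h4
  rw [h2, hB, zero_sub, abs_neg] at h5
  rw [← integral_Ioc_eq_integral_Ioo,
    ← intervalIntegral.integral_of_le (hy.1.trans hy.2).le]
  linarith

lemma sq_integral_mul_le {α : Type*} [MeasurableSpace α] {μ : Measure α} {f g : α → ℝ}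
    (hf : Integrable (fun a => f a ^ 2) μ) (hg : Integrable (fun a => g a ^ 2) μ)
    (hfg : Integrable (fun a => f a * g a) μ) :
    (∫ a, f a * g a ∂μ) ^ 2 ≤ (∫ a, f a ^ 2 ∂μ) * ∫ a, g a ^ 2 ∂μ := by
  have h : ∀ s : ℝ, 0 ≤ (∫ a, f a ^ 2 ∂μ) * (s * s) + (2 * ∫ a, f a * g a ∂μ) * s
      + ∫ a, g a ^ 2 ∂μ := by
    intro s
    have e : (∫ a, f a ^ 2 ∂μ) * (s * s) + (2 * ∫ a, f a * g a ∂μ) * s + ∫ a, g a ^ 2 ∂μ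
        = ∫ a, (f a ^ 2 * (s * s) + f a * g a * (2 * s) + g a ^ 2) ∂μ := by
      have hs : Integrable (fun a => f a ^ 2 * (s * s) + f a * g a * (2 * s)) μ :=
        (hf.mul_const _).add (hfg.mul_const _)
      rw [integral_add hs hg,
        integral_add (hf.mul_const _) (hfg.mul_const _), integral_mul_const, integral_mul_const]
      ring
    rw [e]
    exact integral_nonneg fun a => by
      have : f a ^ 2 * (s * s) + f a * g a * (2 * s) + g a ^ 2 = (f a * s + g a) ^ 2 := by ring
      simpa only [Pi.zero_apply, this] using sq_nonneg _
  have := discrim_le_zero h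
  rw [discrim] at this
  linarith

/-! ### Integration over the strip -/

lemma volume_restrict_strip (B : ℝ) :
    (volume : Measure (ℝ × ℝ)).restrict (strip B)
      = (volume : Measure ℝ).prod (volume.restrict (Ioo 0 B)) := by
  rw [strip, Measure.volume_eq_prod, ← Measure.prod_restrict, Measure.restrict_univ]

lemma setIntegral_strip_deriv_x {B : ℝ} {P F : ℝ → ℝ → ℝ}
    (hF : IntegrableOn (fun p : ℝ × ℝ => F p.1 p.2) (strip B))
    (hP : ∀ y ∈ Ioo 0 B, ∀ x, HasDerivAt (fun x' => P x' y) (F x y) x)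
    (hbot : ∀ y ∈ Ioo 0 B, Filter.Tendsto (fun x => P x y) Filter.atBot (nhds 0))
    (htop : ∀ y ∈ Ioo 0 B, Filter.Tendsto (fun x => P x y) Filter.atTop (nhds 0)) :
    ∫ p in strip B, F p.1 p.2 = 0 := by
  rw [IntegrableOn, volume_restrict_strip] at hF
  rw [volume_restrict_strip, integral_prod_symm _ hF]
  refine integral_eq_zero_of_ae ?_
  filter_upwards [hF.prod_left_ae, ae_restrict_mem measurableSet_Ioo] with y hy hyB
  simpa using integral_of_hasDerivAt_of_tendsto (hP y hyB) hy (hbot y hyB) (htop y hyB)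

lemma setIntegral_strip_deriv_y {B : ℝ} (hB : 0 ≤ B) {Q F : ℝ → ℝ → ℝ}
    (hF : IntegrableOn (fun p : ℝ × ℝ => F p.1 p.2) (strip B))
    (hc : ∀ x, Continuous (F x))
    (hQ : ∀ x y, HasDerivAt (Q x) (F x y) y)
    (h0 : ∀ x, Q x 0 = 0) (hQB : ∀ x, Q x B = 0) :
    ∫ p in strip B, F p.1 p.2 = 0 := by
  rw [IntegrableOn, volume_restrict_strip] at hF
  rw [volume_restrict_strip, integral_prod _ hF]
  refine integral_eq_zero_of_ae (Filter.Eventually.of_forall fun x => ?_)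
  have := intervalIntegral.integral_eq_sub_of_hasDerivAt (fun s _ => hQ x s)
    ((hc x).intervalIntegrable 0 B)
  simp only [Pi.zero_apply]
  rw [← integral_Ioc_eq_integral_Ioo, ← intervalIntegral.integral_of_le hB, this, h0, hQB,
    sub_zero]

lemma Continuous.integrableOn_Ioo {f : ℝ → ℝ} (hf : Continuous f) (a c : ℝ) :
    IntegrableOn f (Ioo a c) :=
  (hf.integrableOn_Icc (a := a) (b := c)).mono_set Ioo_subset_Icc_self

/-- A Poincaré inequality in the bounded direction of the strip. -/
lemma poincare_strip {B : ℝ} (hB : 0 ≤ B) {v vy : ℝ → ℝ → ℝ}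
    (hcv : Continuous fun p : ℝ × ℝ => v p.1 p.2)
    (hcy : Continuous fun p : ℝ × ℝ => vy p.1 p.2)
    (hvy : ∀ x y, HasDerivAt (v x) (vy x y) y) (h0 : ∀ x, v x 0 = 0) (h1 : ∀ x, v x B = 0)
    (iv : IntegrableOn (fun p : ℝ × ℝ => v p.1 p.2 ^ 2) (strip B))
    (ivy : IntegrableOn (fun p : ℝ × ℝ => vy p.1 p.2 ^ 2) (strip B)) :
    ∫ p in strip B, v p.1 p.2 ^ 2 ≤ B ^ 2 / 4 * ∫ p in strip B, vy p.1 p.2 ^ 2 := by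
  rw [IntegrableOn, volume_restrict_strip] at iv ivy
  rw [volume_restrict_strip, integral_prod _ iv, integral_prod _ ivy, ← integral_const_mul]
  refine integral_mono iv.integral_prod_left (ivy.integral_prod_left.const_mul _) fun x => ?_
  have hcx : Continuous (vy x) := hcy.comp (Continuous.prodMk_right x)
  have hcvx : Continuous (v x) := hcv.comp (Continuous.prodMk_right x)
  have hvol : ∫ _ in Ioo 0 B, (1 : ℝ) ^ 2 = B := by simp [hB]
  have hcs := sq_integral_mul_le (μ := volume.restrict (Ioo 0 B)) (f := fun _ => (1 : ℝ))
    (g := fun y => |vy x y|) (Continuous.integrableOn_Ioo (by fun_prop) 0 B)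
    (Continuous.integrableOn_Ioo (by fun_prop) 0 B)
    (Continuous.integrableOn_Ioo (by fun_prop) 0 B)
  simp only [one_mul, sq_abs] at hcs
  rw [hvol] at hcs
  have hpt : ∀ y ∈ Ioo 0 B, v x y ^ 2 ≤ B / 4 * ∫ s in Ioo 0 B, vy x s ^ 2 := by
    intro y hy
    have hs := le_half_setIntegral_abs_deriv (hvy x) hcx (h0 x) (h1 x) hy
    have := pow_le_pow_left₀ (abs_nonneg _) hs 2
    rw [sq_abs] at this
    nlinarith
  have hint := setIntegral_mono_on (hcvx.pow 2 |>.integrableOn_Ioo 0 B)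
    (continuous_const.integrableOn_Ioo 0 B) measurableSet_Ioo hpt
  rw [setIntegral_const] at hint
  simp only [measureReal_def, Real.volume_Ioo, sub_zero, ENNReal.toReal_ofReal hB,
    smul_eq_mul] at hint
  refine hint.trans (le_of_eq ?_)
  ring

/-- Ladyzhenskaya's inequality on the strip. -/
lemma ladyzhenskaya_strip {B : ℝ} {v vx vy : ℝ → ℝ → ℝ}
    (hcv : Continuous fun p : ℝ × ℝ => v p.1 p.2)
    (hcy : Continuous fun p : ℝ × ℝ => vy p.1 p.2)
    (hvx : ∀ x y, HasDerivAt (fun x' => v x' y) (vx x y) x)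
    (hvy : ∀ x y, HasDerivAt (v x) (vy x y) y) (h0 : ∀ x, v x 0 = 0) (h1 : ∀ x, v x B = 0)
    (hbot : ∀ y ∈ Ioo 0 B, Filter.Tendsto (fun x => v x y) Filter.atBot (nhds 0))
    (htop : ∀ y ∈ Ioo 0 B, Filter.Tendsto (fun x => v x y) Filter.atTop (nhds 0))
    (ix : IntegrableOn (fun p : ℝ × ℝ => v p.1 p.2 * vx p.1 p.2) (strip B))
    (iy : IntegrableOn (fun p : ℝ × ℝ => v p.1 p.2 * vy p.1 p.2) (strip B)) :
    IntegrableOn (fun p : ℝ × ℝ => (v p.1 p.2 ^ 2) ^ 2) (strip B) ∧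
    ∫ p in strip B, (v p.1 p.2 ^ 2) ^ 2
      ≤ (∫ p in strip B, |v p.1 p.2 * vx p.1 p.2|)
        * ∫ p in strip B, |v p.1 p.2 * vy p.1 p.2| := by
  rw [IntegrableOn, volume_restrict_strip] at ix iy
  rw [IntegrableOn, volume_restrict_strip]
  set ν := (volume : Measure ℝ).restrict (Ioo 0 B) with hν
  have hdx : ∀ᵐ y ∂ν, ∀ x, v x y ^ 2 ≤ ∫ s, |v s y * vx s y| := by
    filter_upwards [ix.prod_left_ae, ae_restrict_mem measurableSet_Ioo] with y hy hyB x
    have hd : ∀ x, HasDerivAt (fun x' => v x' y ^ 2) (2 * (v x y * vx x y)) x := fun x => by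
      refine ((hvx x y).pow 2).congr_deriv ?_
      simp only [Nat.cast_ofNat]
      ring
    have := le_half_integral_abs_deriv hd (hy.const_mul 2)
      (by simpa using (hbot y hyB).pow 2) (by simpa using (htop y hyB).pow 2) x
    simp only [abs_mul (2 : ℝ), integral_const_mul, abs_two] at this
    linarith [le_abs_self (v x y ^ 2)]
  have hdy : ∀ x, ∀ y ∈ Ioo 0 B, v x y ^ 2 ≤ ∫ s in Ioo 0 B, |v x s * vy x s| := by
    intro x y hy
    have hd : ∀ y, HasDerivAt (fun y' => v x y' ^ 2) (2 * (v x y * vy x y)) y := fun y => by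
      refine ((hvy x y).pow 2).congr_deriv ?_
      simp only [Nat.cast_ofNat]
      ring
    have hcx : Continuous (vy x) := hcy.comp (Continuous.prodMk_right x)
    have hcvx : Continuous (v x) := hcv.comp (Continuous.prodMk_right x)
    have := le_half_setIntegral_abs_deriv hd (by fun_prop) (by simp [h0]) (by simp [h1]) hy
    simp only [abs_mul (2 : ℝ), integral_const_mul, abs_two] at this
    linarith [le_abs_self (v x y ^ 2)]
  have hq := iy.abs.integral_prod_left
  have hp := ix.abs.integral_prod_right
  have hbound : ∀ᵐ p ∂(volume : Measure ℝ).prod ν, (v p.1 p.2 ^ 2) ^ 2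
      ≤ (∫ y, |v p.1 y * vy p.1 y| ∂ν) * ∫ x, |v x p.2 * vx x p.2| := by
    have hx' := (Measure.quasiMeasurePreserving_snd (μ := (volume : Measure ℝ)) (ν := ν)).ae hdx
    have hy' := (Measure.quasiMeasurePreserving_snd (μ := (volume : Measure ℝ)) (ν := ν)).ae
      (ae_restrict_mem (μ := volume) (measurableSet_Ioo (a := 0) (b := B)))
    filter_upwards [hx', hy'] with p h1 h2
    rw [sq]
    exact mul_le_mul (hdy p.1 p.2 h2) (h1 p.1) (sq_nonneg _)
      (integral_nonneg fun _ => abs_nonneg _)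
  have hprod := hq.mul_prod hp
  have hint : Integrable (fun p : ℝ × ℝ => (v p.1 p.2 ^ 2) ^ 2)
      ((volume : Measure ℝ).prod ν) := by
    refine hprod.mono' (by fun_prop) ?_
    filter_upwards [hbound] with p h
    rwa [Real.norm_of_nonneg (by positivity)]
  refine ⟨hint, (integral_mono_ae hint hprod hbound).trans (le_of_eq ?_)⟩
  rw [integral_prod_mul (fun x => ∫ y, |v x y * vy x y| ∂ν)
    (fun y => ∫ x, |v x y * vx x y|), integral_prod_symm _ ix.abs, integral_prod _ iy.abs]
  ring

/-- The algebraic inequality closing the weighted energy estimate. -/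
lemma energy_arith {B b X Y V A C U N Q : ℝ} (hB : 0 < B) (hb : 0 < b)
    (hX : 0 ≤ X) (hY : 0 ≤ Y) (hV : 0 ≤ V) (hU : 0 ≤ U)
    (hbL : 5 * b ^ 2 + 2 * b ≤ π ^ 2 / (4 * B ^ 2))
    (hP : V ≤ B ^ 2 / 4 * Y) (hA : A ^ 2 ≤ V * X) (hC : C ^ 2 ≤ V * Y) (hQ : Q ≤ A * C)
    (hN : N ^ 2 ≤ U * Q) (hUB : U ≤ (3 * π / (8 * B)) ^ 2) :
    -(2 + 6 * b) * X - 2 * b * Y + (2 * b ^ 2 + 2 * b ^ 3) * V + 4 * b / 3 * N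
      ≤ -(b * π ^ 2 / (4 * B ^ 2)) * V := by
  have hAC : A * C ≤ V * ((X + Y) / 2) := by
    refine abs_le_of_sq_le_sq' ?_ (by positivity) |>.2
    calc (A * C) ^ 2 = A ^ 2 * C ^ 2 := by ring
      _ ≤ (V * X) * (V * Y) := mul_le_mul hA hC (sq_nonneg _) (by positivity)
      _ = V ^ 2 * (X * Y) := by ring
      _ ≤ V ^ 2 * ((X + Y) / 2) ^ 2 := by
        gcongr
        nlinarith [sq_nonneg (X - Y)]
      _ = _ := by ring
  have hN' : N ≤ 3 * π / 16 * (3 / 4 * Y + 1 / 4 * X) := by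
    refine abs_le_of_sq_le_sq' ?_ (by positivity) |>.2
    calc N ^ 2 ≤ U * Q := hN
      _ ≤ U * (V * ((X + Y) / 2)) := by gcongr; exact hQ.trans hAC
      _ ≤ (3 * π / (8 * B)) ^ 2 * (B ^ 2 / 4 * Y * ((X + Y) / 2)) := by gcongr
      _ = (3 * π / 16) ^ 2 * (Y * ((X + Y) / 2)) := by field_simp; ring
      _ ≤ (3 * π / 16) ^ 2 * (3 / 4 * Y + 1 / 4 * X) ^ 2 := by
        gcongr
        nlinarith [sq_nonneg (X - Y)]
      _ = _ := by ring
  have hLV : π ^ 2 / (4 * B ^ 2) * V ≤ π ^ 2 / 16 * Y := by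
    calc π ^ 2 / (4 * B ^ 2) * V ≤ π ^ 2 / (4 * B ^ 2) * (B ^ 2 / 4 * Y) := by gcongr
      _ = _ := by field_simp; ring
  have hcub : (2 * b + 2 * b ^ 2) * V ≤ π ^ 2 / (4 * B ^ 2) * V := by
    gcongr
    nlinarith [sq_nonneg b]
  have hpi := Real.pi_lt_d2
  have hpi0 := Real.pi_pos
  have h1 : 4 / 3 * N ≤ π / 4 * (3 / 4 * Y + 1 / 4 * X) := by linarith
  have h2 : π * Y ≤ 3.15 * Y := by gcongr
  have h3 : π * X ≤ 3.15 * X := by gcongr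
  have h4 : π ^ 2 * Y ≤ 3.15 ^ 2 * Y := by gcongr
  have key : -6 * X - 2 * Y + (2 * b + 2 * b ^ 2) * V + 4 / 3 * N
      + π ^ 2 / (4 * B ^ 2) * V ≤ 0 := by
    norm_num at h2 h3 h4
    linarith
  have := mul_nonpos_of_nonneg_of_nonpos hb.le key
  have e : b * π ^ 2 / (4 * B ^ 2) * V = b * (π ^ 2 / (4 * B ^ 2) * V) := by ring
  rw [neg_mul (b * π ^ 2 / (4 * B ^ 2)), e]
  linarith

lemma quadratic_le_of_le_bstar {B b : ℝ} (hb : 0 < b)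
    (hbstar : b ≤ (1/5) * (-1 + Real.sqrt (1 + 5*π^2/(4*B^2)))) :
    5 * b ^ 2 + 2 * b ≤ π ^ 2 / (4 * B ^ 2) := by
  have h1 : 5 * b + 1 ≤ Real.sqrt (1 + 5*π^2/(4*B^2)) := by linarith
  have h2 := (Real.le_sqrt (by linarith) (by positivity)).1 h1
  have e : 5*π^2/(4*B^2) = 5 * (π ^ 2 / (4 * B ^ 2)) := by ring
  rw [e] at h2
  linarith

/-! ### Weighted square-integrable functions with uniform decay -/

/-- Continuous functions on the plane that are square integrable over the strip with weight
`1 + e^{2bx}`, and decay uniformly in the corresponding sense as `|x| → ∞`. -/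
structure WeightedDecay (B b : ℝ) (f : ℝ → ℝ → ℝ) : Prop where
  cont : Continuous fun p : ℝ × ℝ => f p.1 p.2
  integ : IntegrableOn (fun p : ℝ × ℝ => (1 + Real.exp (2*b*p.1)) * (f p.1 p.2)^2) (strip B)
  decay : ∀ ε : ℝ, 0 < ε → ∃ R : ℝ, ∀ x : ℝ, R ≤ |x| → ∀ y ∈ Icc (0:ℝ) B,
    (1 + Real.exp (2*b*x)) * (f x y)^2 ≤ ε

lemma exp_le_one_add_exp {a b : ℝ} (ha : 0 ≤ a) (hab : a ≤ b) (x : ℝ) :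
    Real.exp (2*a*x) ≤ 1 + Real.exp (2*b*x) := by
  rcases le_total x 0 with hx | hx
  · have : Real.exp (2*a*x) ≤ 1 := Real.exp_le_one_iff.2 (by nlinarith)
    linarith [Real.exp_pos (2*b*x)]
  · have : Real.exp (2*a*x) ≤ Real.exp (2*b*x) := Real.exp_le_exp.2 (by nlinarith)
    linarith

lemma abs_exp_mul_mul_le {a b : ℝ} (ha : 0 ≤ a) (hab : a ≤ b) (x c d : ℝ) :
    |Real.exp (2*a*x) * (c * d)|
      ≤ (1 + Real.exp (2*b*x)) * c ^ 2 + (1 + Real.exp (2*b*x)) * d ^ 2 := by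
  rw [abs_mul, abs_of_pos (Real.exp_pos _), ← mul_add]
  refine mul_le_mul (exp_le_one_add_exp ha hab x) ?_ (abs_nonneg _) (by positivity)
  rw [abs_le]
  constructor <;> nlinarith [sq_nonneg (c + d), sq_nonneg (c - d)]

lemma hasDerivAt_exp_weight (a x : ℝ) :
    HasDerivAt (fun x' => Real.exp (2*a*x')) (2*a*Real.exp (2*a*x)) x := by
  have := ((hasDerivAt_id x).const_mul (2*a)).exp
  simpa [mul_comm] using this

lemma measurableSet_strip (B : ℝ) : MeasurableSet (strip B) :=
  MeasurableSet.univ.prod measurableSet_Ioo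

/-- The weighted pairing `∫_S e^{2ax} f g`. -/
noncomputable def weightedInner (B a : ℝ) (f g : ℝ → ℝ → ℝ) : ℝ :=
  ∫ p in strip B, Real.exp (2*a*p.1) * (f p.1 p.2 * g p.1 p.2)

lemma weightedInner_comm (B a : ℝ) (f g : ℝ → ℝ → ℝ) :
    weightedInner B a f g = weightedInner B a g f := by
  simp only [weightedInner, mul_comm (f _ _)]

lemma weightedInner_const_mul (B a c : ℝ) (f g : ℝ → ℝ → ℝ) :
    weightedInner B a f (fun x y => c * g x y) = c * weightedInner B a f g := by
  rw [weightedInner, weightedInner, ← integral_const_mul]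
  congr 1 with p
  ring

lemma weightedInner_self_nonneg (B a : ℝ) (f : ℝ → ℝ → ℝ) : 0 ≤ weightedInner B a f f :=
  integral_nonneg fun _ => mul_nonneg (Real.exp_pos _).le (mul_self_nonneg _)

namespace WeightedDecay

variable {B a b : ℝ} {f g : ℝ → ℝ → ℝ}

lemma exists_bound (hf : WeightedDecay B b f) :
    ∃ C : ℝ, 0 ≤ C ∧ ∀ x, ∀ y ∈ Icc (0:ℝ) B, f x y ^ 2 ≤ C := by
  obtain ⟨R, hR⟩ := hf.decay 1 one_pos
  obtain ⟨C, hC⟩ := ((isCompact_Icc (a := -R) (b := R)).prod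
    (isCompact_Icc (a := (0:ℝ)) (b := B))).exists_bound_of_continuousOn
      (hf.cont.pow 2).continuousOn
  refine ⟨max 1 C, le_trans zero_le_one (le_max_left _ _), fun x y hy => ?_⟩
  rcases le_total R |x| with hx | hx
  · have h := hR x hx y hy
    refine le_trans ?_ (h.trans (le_max_left _ _))
    nlinarith [sq_nonneg (f x y), Real.exp_pos (2*b*x)]
  · exact (le_abs_self _).trans ((hC (x, y) ⟨abs_le.1 hx, hy⟩).trans (le_max_right _ _))

lemma mul (hf : WeightedDecay B b f) (hg : WeightedDecay B b g) :
    WeightedDecay B b fun x y => f x y * g x y := by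
  obtain ⟨C, hC0, hC⟩ := hg.exists_bound
  have key : ∀ x, ∀ y ∈ Icc (0:ℝ) B, (1 + Real.exp (2*b*x)) * (f x y * g x y)^2
      ≤ C * ((1 + Real.exp (2*b*x)) * (f x y)^2) := fun x y hy => by
    calc (1 + Real.exp (2*b*x)) * (f x y * g x y)^2
        = (g x y)^2 * ((1 + Real.exp (2*b*x)) * (f x y)^2) := by ring
      _ ≤ _ := mul_le_mul_of_nonneg_right (hC x y hy) (by positivity)
  have cf := hf.cont
  have cg := hg.cont
  refine ⟨cf.mul cg, ?_, fun ε hε => ?_⟩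
  · refine (hf.integ.const_mul C).mono' (by fun_prop) ?_
    filter_upwards [ae_restrict_mem (measurableSet_strip B)] with p hp
    rw [Real.norm_of_nonneg (by positivity)]
    exact key p.1 p.2 (Ioo_subset_Icc_self hp.2)
  · obtain ⟨R, hR⟩ := hf.decay (ε / (C + 1)) (by positivity)
    refine ⟨R, fun x hx y hy => (key x y hy).trans ?_⟩
    calc C * ((1 + Real.exp (2*b*x)) * (f x y)^2) ≤ (C + 1) * (ε / (C + 1)) :=
          mul_le_mul (by linarith) (hR x hx y hy) (by positivity) (by positivity)
      _ = ε := by field_simp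

lemma const_mul (c : ℝ) (hf : WeightedDecay B b f) :
    WeightedDecay B b fun x y => c * f x y := by
  have key : ∀ x y, (1 + Real.exp (2*b*x)) * (c * f x y)^2
      = c^2 * ((1 + Real.exp (2*b*x)) * (f x y)^2) := fun x y => by ring
  refine ⟨continuous_const.mul hf.cont, ?_, fun ε hε => ?_⟩
  · simp only [key]
    exact hf.integ.const_mul (c^2)
  · obtain ⟨R, hR⟩ := hf.decay (ε / (c^2 + 1)) (by positivity)
    refine ⟨R, fun x hx y hy => ?_⟩
    rw [key]
    calc c^2 * ((1 + Real.exp (2*b*x)) * (f x y)^2) ≤ (c^2 + 1) * (ε / (c^2 + 1)) :=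
          mul_le_mul (by linarith) (hR x hx y hy) (by positivity) (by positivity)
      _ = ε := by field_simp

lemma add (hf : WeightedDecay B b f) (hg : WeightedDecay B b g) :
    WeightedDecay B b fun x y => f x y + g x y := by
  have key : ∀ x y, (1 + Real.exp (2*b*x)) * (f x y + g x y)^2
      ≤ 2 * ((1 + Real.exp (2*b*x)) * (f x y)^2) + 2 * ((1 + Real.exp (2*b*x)) * (g x y)^2) :=
    fun x y => by
      have : 0 ≤ (1 + Real.exp (2*b*x)) * (f x y - g x y)^2 := by positivity
      linarith
  have cf := hf.cont
  have cg := hg.cont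
  refine ⟨cf.add cg, ?_, fun ε hε => ?_⟩
  · refine ((hf.integ.const_mul 2).add (hg.integ.const_mul 2)).mono' (by fun_prop)
      (Filter.Eventually.of_forall fun p => ?_)
    rw [Real.norm_of_nonneg (by positivity)]
    exact key p.1 p.2
  · obtain ⟨R, hR⟩ := hf.decay (ε / 4) (by positivity)
    obtain ⟨R', hR'⟩ := hg.decay (ε / 4) (by positivity)
    refine ⟨max R R', fun x hx y hy => (key x y).trans ?_⟩
    linarith [hR x ((le_max_left _ _).trans hx) y hy, hR' x ((le_max_right _ _).trans hx) y hy]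

lemma integrableOn_exp_mul (ha : 0 ≤ a) (hab : a ≤ b) (hf : WeightedDecay B b f)
    (hg : WeightedDecay B b g) :
    IntegrableOn (fun p : ℝ × ℝ => Real.exp (2*a*p.1) * (f p.1 p.2 * g p.1 p.2)) (strip B) := by
  have cf := hf.cont
  have cg := hg.cont
  exact (hf.integ.add hg.integ).mono' (by fun_prop)
    (Filter.Eventually.of_forall fun p => abs_exp_mul_mul_le ha hab _ _ _)

lemma tendsto_weight (hf : WeightedDecay B b f) {y : ℝ} (hy : y ∈ Icc 0 B) :
    Filter.Tendsto (fun x => (1 + Real.exp (2*b*x)) * (f x y)^2)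
      (Filter.atBot ⊔ Filter.atTop) (nhds 0) := by
  rw [Metric.tendsto_nhds]
  intro ε hε
  obtain ⟨R, hR⟩ := hf.decay (ε / 2) (half_pos hε)
  have hx : ∀ᶠ x : ℝ in Filter.atBot ⊔ Filter.atTop, R ≤ |x| :=
    Filter.eventually_sup.2 ⟨Filter.tendsto_abs_atBot_atTop.eventually_ge_atTop R,
      Filter.tendsto_abs_atTop_atTop.eventually_ge_atTop R⟩
  filter_upwards [hx] with x hx
  rw [Real.dist_eq, sub_zero, abs_of_nonneg (by positivity)]
  linarith [hR x hx y hy]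

lemma tendsto_exp_mul (ha : 0 ≤ a) (hab : a ≤ b) (hf : WeightedDecay B b f)
    (hg : WeightedDecay B b g) {y : ℝ} (hy : y ∈ Icc 0 B) :
    Filter.Tendsto (fun x => Real.exp (2*a*x) * (f x y * g x y))
      (Filter.atBot ⊔ Filter.atTop) (nhds 0) := by
  refine squeeze_zero_norm (fun x => abs_exp_mul_mul_le ha hab x _ _) ?_
  simpa using (hf.tendsto_weight hy).add (hg.tendsto_weight hy)

lemma weightedInner_add {h : ℝ → ℝ → ℝ} (ha : 0 ≤ a) (hab : a ≤ b) (hf : WeightedDecay B b f)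
    (hg : WeightedDecay B b g) (hh : WeightedDecay B b h) :
    weightedInner B a f (fun x y => g x y + h x y)
      = weightedInner B a f g + weightedInner B a f h := by
  rw [weightedInner, weightedInner, weightedInner,
    ← integral_add (hf.integrableOn_exp_mul ha hab hg) (hf.integrableOn_exp_mul ha hab hh)]
  congr 1 with p
  ring

/-- Integration by parts in `x` against the weight `e^{2ax}`. -/
lemma integral_parts_x {f' g' : ℝ → ℝ → ℝ} (ha : 0 ≤ a) (hab : a ≤ b)
    (hf : WeightedDecay B b f) (hg : WeightedDecay B b g)
    (hf' : WeightedDecay B b f') (hg' : WeightedDecay B b g')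
    (df : ∀ x y, HasDerivAt (fun x' => f x' y) (f' x y) x)
    (dg : ∀ x y, HasDerivAt (fun x' => g x' y) (g' x y) x) :
    2*a * weightedInner B a f g + weightedInner B a f' g + weightedInner B a f g' = 0 := by
  have i1 := (hf.integrableOn_exp_mul ha hab hg).const_mul (2*a)
  have i2 := hf'.integrableOn_exp_mul ha hab hg
  have i3 := hf.integrableOn_exp_mul ha hab hg'
  have i12 : IntegrableOn (fun p : ℝ × ℝ => 2*a * (Real.exp (2*a*p.1) * (f p.1 p.2 * g p.1 p.2))
      + Real.exp (2*a*p.1) * (f' p.1 p.2 * g p.1 p.2)) (strip B) := i1.add i2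
  simp only [weightedInner]
  rw [← integral_const_mul, ← integral_add i1 i2, ← integral_add i12 i3]
  have hlim := fun (y : ℝ) (hy : y ∈ Ioo 0 B) =>
    hf.tendsto_exp_mul ha hab hg (Ioo_subset_Icc_self hy)
  refine setIntegral_strip_deriv_x (P := fun x y => Real.exp (2*a*x) * (f x y * g x y))
    (F := fun x y => 2*a * (Real.exp (2*a*x) * (f x y * g x y))
      + Real.exp (2*a*x) * (f' x y * g x y) + Real.exp (2*a*x) * (f x y * g' x y))
    (i12.add i3) (fun y _ x => ?_) (fun y hy => (hlim y hy).mono_left le_sup_left)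
    (fun y hy => (hlim y hy).mono_left le_sup_right)
  refine ((hasDerivAt_exp_weight a x).mul ((df x y).mul (dg x y))).congr_deriv ?_
  simp only [Pi.mul_apply]
  ring

/-- Integration by parts in `y` against the weight `e^{2ax}`, with vanishing boundary values. -/
lemma integral_parts_y {f' g' : ℝ → ℝ → ℝ} (hB : 0 ≤ B) (ha : 0 ≤ a) (hab : a ≤ b)
    (hf : WeightedDecay B b f) (hg : WeightedDecay B b g)
    (hf' : WeightedDecay B b f') (hg' : WeightedDecay B b g')
    (df : ∀ x y, HasDerivAt (f x) (f' x y) y) (dg : ∀ x y, HasDerivAt (g x) (g' x y) y)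
    (h0 : ∀ x, f x 0 = 0) (h1 : ∀ x, f x B = 0) :
    weightedInner B a f' g + weightedInner B a f g' = 0 := by
  have i2 := hf'.integrableOn_exp_mul ha hab hg
  have i3 := hf.integrableOn_exp_mul ha hab hg'
  simp only [weightedInner]
  rw [← integral_add i2 i3]
  refine setIntegral_strip_deriv_y hB (Q := fun x y => Real.exp (2*a*x) * (f x y * g x y))
    (F := fun x y => Real.exp (2*a*x) * (f' x y * g x y) + Real.exp (2*a*x) * (f x y * g' x y))
    (i2.add i3) (fun x => ?_) (fun x y => ?_) (fun x => by simp [h0]) (fun x => by simp [h1])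
  · have c1 : Continuous (f x) := hf.cont.comp (Continuous.prodMk_right x)
    have c2 : Continuous (g x) := hg.cont.comp (Continuous.prodMk_right x)
    have c3 : Continuous (f' x) := hf'.cont.comp (Continuous.prodMk_right x)
    have c4 : Continuous (g' x) := hg'.cont.comp (Continuous.prodMk_right x)
    fun_prop
  · refine (((df x y).mul (dg x y)).const_mul (Real.exp (2*a*x))).congr_deriv ?_
    ring

end WeightedDecay

section Solution

variable {B a b : ℝ} {u : ℝ → ℝ → ℝ → ℝ}

lemma IsZKBSolution.weightedDecay (hu : IsZKBSolution B b u) {i j k : ℕ} (h : i + j + k ≤ 5)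
    {t : ℝ} (ht : 0 ≤ t) : WeightedDecay B b fun x y => pd i j k u x y t where
  cont := (contDiff_pd hu.smooth i j k).continuous.comp
    (f := fun p : ℝ × ℝ => (p.1, p.2, t)) (by fun_prop)
  integ := hu.integ i j k h t ht
  decay ε hε := by
    obtain ⟨R, hR⟩ := hu.decay i j k h t ε hε
    exact ⟨R, fun x hx y hy => hR x hx y hy t ⟨ht, le_rfl⟩⟩

lemma IsZKBSolution.weightedDecay_self (hu : IsZKBSolution B b u) {t : ℝ} (ht : 0 ≤ t) :
    WeightedDecay B b fun x y => u x y t := by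
  simpa only [pd_zero] using hu.weightedDecay (i := 0) (j := 0) (k := 0) (by norm_num) ht

lemma IsZKBSolution.hasDerivAt_x (hu : IsZKBSolution B b u) (x y t : ℝ) :
    HasDerivAt (fun x' => u x' y t) (pd 1 0 0 u x y t) x := by
  simpa only [pd_zero] using hasDerivAt_pd_x hu.smooth 0 0 0 x y t

lemma IsZKBSolution.hasDerivAt_y (hu : IsZKBSolution B b u) (x y t : ℝ) :
    HasDerivAt (fun y' => u x y' t) (pd 0 1 0 u x y t) y := by
  simpa only [pd_zero] using hasDerivAt_pd_y hu.smooth 0 0 x y t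

lemma IsZKBSolution.hasDerivAt_t (hu : IsZKBSolution B b u) (x y t : ℝ) :
    HasDerivAt (fun t' => u x y t') (pd 0 0 1 u x y t) t := by
  simpa only [pd_zero] using hasDerivAt_pd_t hu.smooth 0 x y t

/-- The weighted energy identity at a fixed positive time. -/
lemma IsZKBSolution.energy_identity (hu : IsZKBSolution B b u) (hB : 0 < B)
    (ha : 0 ≤ a) (hab : a ≤ b) {t : ℝ} (ht : 0 < t) :
    weightedInner B a (fun x y => u x y t) (fun x y => pd 0 0 1 u x y t)
      = -(1 + 3*a) * weightedInner B a (fun x y => pd 1 0 0 u x y t + a * u x y t)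
          (fun x y => pd 1 0 0 u x y t + a * u x y t)
        - a * weightedInner B a (fun x y => pd 0 1 0 u x y t) (fun x y => pd 0 1 0 u x y t)
        + (a^2 + a^3) * weightedInner B a (fun x y => u x y t) (fun x y => u x y t)
        + 2*a/3 * weightedInner B a (fun x y => u x y t) (fun x y => u x y t * u x y t) := by
  have W : ∀ {i j k : ℕ}, i + j + k ≤ 5 → WeightedDecay B b fun x y => pd i j k u x y t :=
    fun h => hu.weightedDecay h ht.le
  have w0 := hu.weightedDecay_self ht.le
  have wx := W (i := 1) (j := 0) (k := 0) (by norm_num)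
  have wxx := W (i := 2) (j := 0) (k := 0) (by norm_num)
  have wxxx := W (i := 3) (j := 0) (k := 0) (by norm_num)
  have wy := W (i := 0) (j := 1) (k := 0) (by norm_num)
  have wxy := W (i := 1) (j := 1) (k := 0) (by norm_num)
  have wxyy := W (i := 1) (j := 2) (k := 0) (by norm_num)
  have wt := W (i := 0) (j := 0) (k := 1) (by norm_num)
  have I : ∀ {f g : ℝ → ℝ → ℝ}, WeightedDecay B b f → WeightedDecay B b g →
      IntegrableOn (fun p : ℝ × ℝ => Real.exp (2*a*p.1) * (f p.1 p.2 * g p.1 p.2)) (strip B) :=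
    fun hf hg => hf.integrableOn_exp_mul ha hab hg
  have D := fun i j => hasDerivAt_pd_x hu.smooth (t := t) i j 0
  have p1 := w0.integral_parts_x ha hab wx wx wxx (fun x y => hu.hasDerivAt_x x y t)
    fun x y => D 1 0 x y
  have p2 := w0.integral_parts_x ha hab w0 wx wx (fun x y => hu.hasDerivAt_x x y t)
    fun x y => hu.hasDerivAt_x x y t
  have p3 := w0.integral_parts_x ha hab (w0.mul w0) wx ((wx.mul w0).add (w0.mul wx))
    (fun x y => hu.hasDerivAt_x x y t)
    (fun x y => (hu.hasDerivAt_x x y t).mul (hu.hasDerivAt_x x y t))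
  have p4 := w0.integral_parts_x ha hab wxx wx wxxx (fun x y => hu.hasDerivAt_x x y t)
    fun x y => D 2 0 x y
  have p5 := wx.integral_parts_x ha hab wx wxx wxx (fun x y => D 1 0 x y) fun x y => D 1 0 x y
  have p6 := wy.integral_parts_x ha hab wy wxy wxy (fun x y => D 0 1 x y) fun x y => D 0 1 x y
  have p7 := w0.integral_parts_y hB.le ha hab wxy wy wxyy (fun x y => hu.hasDerivAt_y x y t)
    (fun x y => hasDerivAt_pd_one_y hu.smooth 1 0 x y t) (fun x => hu.bdry0 x t ht.le)
    (fun x => hu.bdryB x t ht.le)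
  have c3 : weightedInner B a (fun x y => pd 1 0 0 u x y t) (fun x y => u x y t * u x y t)
      = weightedInner B a (fun x y => u x y t) (fun x y => u x y t * pd 1 0 0 u x y t) := by
    simp only [weightedInner]
    congr 1 with p
    ring
  have c3' : weightedInner B a (fun x y => u x y t) (fun x y => pd 1 0 0 u x y t * u x y t)
      = weightedInner B a (fun x y => u x y t) (fun x y => u x y t * pd 1 0 0 u x y t) := by
    simp only [mul_comm]
  rw [w0.weightedInner_add ha hab (wx.mul w0) (w0.mul wx), c3, c3'] at p3
  have hsq : weightedInner B a (fun x y => pd 1 0 0 u x y t + a * u x y t)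
        (fun x y => pd 1 0 0 u x y t + a * u x y t)
      = weightedInner B a (fun x y => pd 1 0 0 u x y t) (fun x y => pd 1 0 0 u x y t)
        + 2*a * weightedInner B a (fun x y => u x y t) (fun x y => pd 1 0 0 u x y t)
        + a^2 * weightedInner B a (fun x y => u x y t) (fun x y => u x y t) := by
    have ws := wx.add (w0.const_mul a)
    rw [ws.weightedInner_add ha hab wx (w0.const_mul a), weightedInner_const_mul,
      weightedInner_comm B a _ (fun x y => pd 1 0 0 u x y t),
      weightedInner_comm B a _ (fun x y => u x y t),
      wx.weightedInner_add ha hab wx (w0.const_mul a),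
      w0.weightedInner_add ha hab wx (w0.const_mul a),
      weightedInner_const_mul, weightedInner_const_mul,
      weightedInner_comm B a (fun x y => pd 1 0 0 u x y t) (fun x y => u x y t)]
    ring
  have hut : weightedInner B a (fun x y => u x y t) (fun x y => pd 0 0 1 u x y t)
      = weightedInner B a (fun x y => u x y t) (fun x y => pd 2 0 0 u x y t +
          (-1 * (u x y t * pd 1 0 0 u x y t) +
            (-1 * pd 3 0 0 u x y t + -1 * pd 1 2 0 u x y t))) := by
    refine setIntegral_congr_fun (measurableSet_strip B) fun p hp => ?_
    have := hu.pde p.1 p.2 hp.2 t ht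
    simp only
    rw [show pd 0 0 1 u p.1 p.2 t = pd 2 0 0 u p.1 p.2 t +
          (-1 * (u p.1 p.2 t * pd 1 0 0 u p.1 p.2 t) +
            (-1 * pd 3 0 0 u p.1 p.2 t + -1 * pd 1 2 0 u p.1 p.2 t)) by linarith]
  have w3 := (wxxx.const_mul (-1)).add (wxyy.const_mul (-1))
  rw [w0.weightedInner_add ha hab wxx (((w0.mul wx).const_mul (-1)).add w3),
    w0.weightedInner_add ha hab ((w0.mul wx).const_mul (-1)) w3,
    w0.weightedInner_add ha hab (wxxx.const_mul (-1)) (wxyy.const_mul (-1)),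
    weightedInner_const_mul, weightedInner_const_mul, weightedInner_const_mul] at hut
  rw [weightedInner_comm B a (fun x y => pd 1 0 0 u x y t) (fun x y => u x y t)] at p2
  rw [weightedInner_comm B a (fun x y => pd 2 0 0 u x y t) (fun x y => pd 1 0 0 u x y t)] at p5
  rw [weightedInner_comm B a (fun x y => pd 1 1 0 u x y t) (fun x y => pd 0 1 0 u x y t)] at p6
  rw [hut, hsq]
  linear_combination (1 + 2*a) * p1 + a^2 * p2 - 1/3 * p3 - p4 + 1/2 * p5 + 1/2 * p6 - p7


/-- Nonpositivity of the time derivative of `e^{ct} ∫_S e^{2ax} u²` bounds that quantity by its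
initial value. -/
lemma IsZKBSolution.exp_mul_weightedInner_le (hu : IsZKBSolution B b u)
    (ha : 0 ≤ a) (hab : a ≤ b) (c : ℝ) {T : ℝ} (hT : 0 ≤ T)
    (h : ∀ s ∈ Ioc 0 T, c * weightedInner B a (fun x y => u x y s) (fun x y => u x y s)
      + 2 * weightedInner B a (fun x y => u x y s) (fun x y => pd 0 0 1 u x y s) ≤ 0) :
    Real.exp (c*T) * weightedInner B a (fun x y => u x y T) (fun x y => u x y T)
      ≤ weightedInner B a (fun x y => u x y 0) (fun x y => u x y 0) := by
  set μ := (volume : Measure (ℝ × ℝ)).restrict (strip B) with hμ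
  set ν := (volume : Measure ℝ).restrict (Ioc 0 T) with hν
  have cu : Continuous fun q : ℝ × ℝ × ℝ => u q.1 q.2.1 q.2.2 := hu.smooth.continuous
  have cut : Continuous fun q : ℝ × ℝ × ℝ => pd 0 0 1 u q.1 q.2.1 q.2.2 :=
    (contDiff_pd hu.smooth 0 0 1).continuous
  have cu' : Continuous fun q : (ℝ × ℝ) × ℝ => u q.1.1 q.1.2 q.2 :=
    cu.comp (f := fun q : (ℝ × ℝ) × ℝ => (q.1.1, q.1.2, q.2)) (by fun_prop)
  have cut' : Continuous fun q : (ℝ × ℝ) × ℝ => pd 0 0 1 u q.1.1 q.1.2 q.2 :=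
    cut.comp (f := fun q : (ℝ × ℝ) × ℝ => (q.1.1, q.1.2, q.2)) (by fun_prop)
  let F : ℝ × ℝ → ℝ → ℝ := fun p s => Real.exp (c*s) *
    (c * (Real.exp (2*a*p.1) * (u p.1 p.2 s * u p.1 p.2 s))
      + 2 * (Real.exp (2*a*p.1) * (u p.1 p.2 s * pd 0 0 1 u p.1 p.2 s)))
  have cF : Continuous (Function.uncurry F) := by
    simp only [F, Function.uncurry_def]
    fun_prop
  have i1 : ∀ s, 0 ≤ s → Integrable (fun p : ℝ × ℝ =>
      Real.exp (2*a*p.1) * (u p.1 p.2 s * u p.1 p.2 s)) μ := fun s hs =>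
    (hu.weightedDecay_self hs).integrableOn_exp_mul ha hab (hu.weightedDecay_self hs)
  have i2 : ∀ s, 0 ≤ s → Integrable (fun p : ℝ × ℝ =>
      Real.exp (2*a*p.1) * (u p.1 p.2 s * pd 0 0 1 u p.1 p.2 s)) μ := fun s hs =>
    (hu.weightedDecay_self hs).integrableOn_exp_mul ha hab
      (hu.weightedDecay (i := 0) (j := 0) (k := 1) (by norm_num) hs)
  have iF : ∀ s, 0 ≤ s → Integrable (fun p => F p s) μ := fun s hs =>
    (((i1 s hs).const_mul c).add ((i2 s hs).const_mul 2)).const_mul _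
  have hint : Integrable (Function.uncurry F) (μ.prod ν) := by
    rw [integrable_prod_iff' cF.aestronglyMeasurable]
    refine ⟨?_, ?_⟩
    · filter_upwards [ae_restrict_mem measurableSet_Ioc] with s hs
      exact iF s hs.1.le
    obtain ⟨M₀, hM₀⟩ := hu.bdd 0 0 0 (by norm_num) T
    obtain ⟨M₁, hM₁⟩ := hu.bdd 0 0 1 (by norm_num) T
    have hmeas : AEStronglyMeasurable (fun s => ∫ p, ‖Function.uncurry F (p, s)‖ ∂μ) ν :=
      (cF.comp continuous_swap).norm.aestronglyMeasurable.integral_prod_right'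
    refine Integrable.of_bound hmeas (Real.exp (|c| * T) * (2 * |c| * M₀ + 2 * (M₀ + M₁))) ?_
    filter_upwards [ae_restrict_mem measurableSet_Ioc] with s hs
    rw [Real.norm_of_nonneg (integral_nonneg fun _ => norm_nonneg _)]
    have j0 := hu.integ 0 0 0 (by norm_num) s hs.1.le
    have j1 := hu.integ 0 0 1 (by norm_num) s hs.1.le
    have b0 := hM₀ s ⟨hs.1.le, hs.2⟩
    have b1 := hM₁ s ⟨hs.1.le, hs.2⟩
    have hexp : Real.exp (c*s) ≤ Real.exp (|c| * T) := Real.exp_le_exp.2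
      ((mul_le_mul_of_nonneg_right (le_abs_self c) hs.1.le).trans
        (mul_le_mul_of_nonneg_left hs.2 (abs_nonneg c)))
    have jsum := ((j0.const_mul (2 * |c|)).add ((j0.add j1).const_mul 2)).const_mul
      (Real.exp (|c| * T))
    calc ∫ p, ‖F p s‖ ∂μ
        ≤ ∫ p, Real.exp (|c| * T) * (2 * |c| * ((1 + Real.exp (2*b*p.1)) * (pd 0 0 0 u p.1 p.2 s)^2)
          + 2 * ((1 + Real.exp (2*b*p.1)) * (pd 0 0 0 u p.1 p.2 s)^2
            + (1 + Real.exp (2*b*p.1)) * (pd 0 0 1 u p.1 p.2 s)^2)) ∂μ := by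
          refine integral_mono (iF s hs.1.le).norm jsum fun p => ?_
          simp only [F, Real.norm_eq_abs, pd_zero]
          rw [abs_mul, abs_of_pos (Real.exp_pos _)]
          refine mul_le_mul hexp ((abs_add_le _ _).trans (add_le_add ?_ ?_)) (abs_nonneg _)
            (Real.exp_pos _).le
          · rw [abs_mul]
            have := abs_exp_mul_mul_le ha hab p.1 (u p.1 p.2 s) (u p.1 p.2 s)
            calc _ ≤ |c| * _ := mul_le_mul_of_nonneg_left this (abs_nonneg c)
              _ = _ := by ring
          · rw [abs_mul, abs_two]
            exact mul_le_mul_of_nonneg_left (abs_exp_mul_mul_le ha hab _ _ _) two_pos.le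
      _ = Real.exp (|c| * T) * (2 * |c| *
            (∫ p, (1 + Real.exp (2*b*p.1)) * (pd 0 0 0 u p.1 p.2 s)^2 ∂μ)
          + 2 * ((∫ p, (1 + Real.exp (2*b*p.1)) * (pd 0 0 0 u p.1 p.2 s)^2 ∂μ)
            + ∫ p, (1 + Real.exp (2*b*p.1)) * (pd 0 0 1 u p.1 p.2 s)^2 ∂μ)) := by
          have j01 : Integrable (fun p : ℝ × ℝ =>
              (1 + Real.exp (2*b*p.1)) * (pd 0 0 0 u p.1 p.2 s)^2
                + (1 + Real.exp (2*b*p.1)) * (pd 0 0 1 u p.1 p.2 s)^2) μ := j0.add j1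
          rw [integral_const_mul, integral_add (j0.const_mul _) (j01.const_mul _),
            integral_const_mul, integral_const_mul, integral_add j0 j1]
      _ ≤ _ := by gcongr
  have hswap := integral_integral_swap hint
  have hleft : ∀ p : ℝ × ℝ, ∫ s, F p s ∂ν
      = Real.exp (c*T) * (Real.exp (2*a*p.1) * (u p.1 p.2 T * u p.1 p.2 T))
        - Real.exp (2*a*p.1) * (u p.1 p.2 0 * u p.1 p.2 0) := by
    intro p
    have hd : ∀ s, HasDerivAt (fun s' => Real.exp (c*s') *
        (Real.exp (2*a*p.1) * (u p.1 p.2 s' * u p.1 p.2 s'))) (F p s) s := fun s => by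
      have he : HasDerivAt (fun s' => Real.exp (c*s')) (c * Real.exp (c*s)) s := by
        simpa [mul_comm] using ((hasDerivAt_id s).const_mul c).exp
      have hp := hu.hasDerivAt_t p.1 p.2 s
      refine (he.mul ((hp.mul hp).const_mul (Real.exp (2*a*p.1)))).congr_deriv ?_
      simp only [F, Pi.mul_apply]
      ring
    have := intervalIntegral.integral_eq_sub_of_hasDerivAt (fun s _ => hd s)
      ((cF.comp (Continuous.prodMk_right p)).intervalIntegrable 0 T)
    rw [intervalIntegral.integral_of_le hT] at this
    simpa using this
  have hright : ∫ s, ∫ p, F p s ∂μ ∂ν ≤ 0 := by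
    refine integral_nonpos_of_ae ?_
    filter_upwards [ae_restrict_mem measurableSet_Ioc] with s hs
    have e : ∫ p, F p s ∂μ
        = Real.exp (c*s) * (c * weightedInner B a (fun x y => u x y s) (fun x y => u x y s)
          + 2 * weightedInner B a (fun x y => u x y s) (fun x y => pd 0 0 1 u x y s)) := by
      simp only [F, weightedInner]
      rw [integral_const_mul, integral_add ((i1 s hs.1.le).const_mul c)
        ((i2 s hs.1.le).const_mul 2), integral_const_mul, integral_const_mul]
    rw [e]
    exact mul_nonpos_of_nonneg_of_nonpos (Real.exp_pos _).le (h s hs)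
  simp only [hleft] at hswap
  rw [integral_sub ((i1 T hT).const_mul _) (i1 0 le_rfl), integral_const_mul] at hswap
  simp only [weightedInner]
  linarith

/-- The `L²` norm of a solution does not increase. -/
lemma IsZKBSolution.weightedInner_zero_le (hu : IsZKBSolution B b u) (hB : 0 < B) (hb : 0 ≤ b)
    {T : ℝ} (hT : 0 ≤ T) :
    weightedInner B 0 (fun x y => u x y T) (fun x y => u x y T)
      ≤ weightedInner B 0 (fun x y => u x y 0) (fun x y => u x y 0) := by
  have := hu.exp_mul_weightedInner_le (a := 0) le_rfl hb 0 hT fun s hs => by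
    rw [hu.energy_identity hB le_rfl hb hs.1]
    have := weightedInner_self_nonneg B 0 (fun x y => pd 1 0 0 u x y s + 0 * u x y s)
    linarith
  simpa using this

/-- The weighted energy decays at rate `bπ²/(4B²)` as long as the `L²` norm is small. -/
lemma IsZKBSolution.weighted_energy_decay (hu : IsZKBSolution B b u) (hB : 0 < B) (hb : 0 < b)
    (hbL : 5 * b ^ 2 + 2 * b ≤ π ^ 2 / (4 * B ^ 2)) {t : ℝ} (ht : 0 < t)
    (hU : weightedInner B 0 (fun x y => u x y t) (fun x y => u x y t) ≤ (3 * π / (8 * B)) ^ 2) :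
    b * π ^ 2 / (4 * B ^ 2) * weightedInner B b (fun x y => u x y t) (fun x y => u x y t)
      + 2 * weightedInner B b (fun x y => u x y t) (fun x y => pd 0 0 1 u x y t) ≤ 0 := by
  have w0 := hu.weightedDecay_self ht.le
  have wx := hu.weightedDecay (i := 1) (j := 0) (k := 0) (by norm_num) ht.le
  have wy := hu.weightedDecay (i := 0) (j := 1) (k := 0) (by norm_num) ht.le
  have ws := wx.add (w0.const_mul b)
  have hE : ∀ x : ℝ, Real.exp (2*b*x) = Real.exp (b*x) * Real.exp (b*x) := fun x => by
    rw [← Real.exp_add]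
    ring_nf
  let v : ℝ → ℝ → ℝ := fun x y => Real.exp (b*x) * u x y t
  let vx : ℝ → ℝ → ℝ := fun x y => Real.exp (b*x) * (pd 1 0 0 u x y t + b * u x y t)
  let vy : ℝ → ℝ → ℝ := fun x y => Real.exp (b*x) * pd 0 1 0 u x y t
  have prod_eq : ∀ (f g : ℝ → ℝ → ℝ) (x y : ℝ), (Real.exp (b*x) * f x y) * (Real.exp (b*x) * g x y)
      = Real.exp (2*b*x) * (f x y * g x y) := fun f g x y => by
    rw [hE]
    ring
  have integ : ∀ {f g : ℝ → ℝ → ℝ}, WeightedDecay B b f → WeightedDecay B b g →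
      IntegrableOn (fun p : ℝ × ℝ => (Real.exp (b*p.1) * f p.1 p.2) * (Real.exp (b*p.1) * g p.1 p.2))
        (strip B) := fun {f g} hf hg => by
    simp only [prod_eq]
    exact hf.integrableOn_exp_mul hb.le le_rfl hg
  have inner_eq : ∀ f g : ℝ → ℝ → ℝ,
      ∫ p in strip B, (Real.exp (b*p.1) * f p.1 p.2) * (Real.exp (b*p.1) * g p.1 p.2)
        = weightedInner B b f g := fun f g => by
    simp only [prod_eq, weightedInner]
  have c0 := w0.cont
  have cs := ws.cont
  have cy := wy.cont
  have cv : Continuous fun p : ℝ × ℝ => v p.1 p.2 := by fun_prop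
  have cvy : Continuous fun p : ℝ × ℝ => vy p.1 p.2 := by fun_prop
  have dvx : ∀ x y, HasDerivAt (fun x' => v x' y) (vx x y) x := fun x y => by
    have he : HasDerivAt (fun x' => Real.exp (b*x')) (b * Real.exp (b*x)) x := by
      simpa [mul_comm] using ((hasDerivAt_id x).const_mul b).exp
    refine (he.mul (hu.hasDerivAt_x x y t)).congr_deriv ?_
    simp only [vx]
    ring
  have dvy : ∀ x y, HasDerivAt (v x) (vy x y) y := fun x y =>
    (hu.hasDerivAt_y x y t).const_mul _
  have v0 : ∀ x, v x 0 = 0 := fun x => by simp [v, hu.bdry0 x t ht.le]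
  have vB : ∀ x, v x B = 0 := fun x => by simp [v, hu.bdryB x t ht.le]
  have hlim : ∀ y ∈ Ioo 0 B, Filter.Tendsto (fun x => v x y)
      (Filter.atBot ⊔ Filter.atTop) (nhds 0) := fun y hy => by
    have h1 := w0.tendsto_exp_mul hb.le le_rfl w0 (Ioo_subset_Icc_self hy)
    have h2 := (Real.continuous_sqrt.tendsto 0).comp h1
    rw [Real.sqrt_zero] at h2
    refine (tendsto_zero_iff_abs_tendsto_zero _).2 (h2.congr fun x => ?_)
    simp only [Function.comp_apply, v]
    rw [← prod_eq (fun x y => u x y t) (fun x y => u x y t), Real.sqrt_mul_self_eq_abs]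
  have ivv : IntegrableOn (fun p : ℝ × ℝ => v p.1 p.2 ^ 2) (strip B) := by
    simpa only [sq] using integ w0 w0
  have ixx : IntegrableOn (fun p : ℝ × ℝ => vx p.1 p.2 ^ 2) (strip B) := by
    simpa only [sq] using integ ws ws
  have iyy : IntegrableOn (fun p : ℝ × ℝ => vy p.1 p.2 ^ 2) (strip B) := by
    simpa only [sq] using integ wy wy
  have eV : ∫ p in strip B, v p.1 p.2 ^ 2
      = weightedInner B b (fun x y => u x y t) (fun x y => u x y t) := by
    simpa only [sq] using inner_eq (fun x y => u x y t) (fun x y => u x y t)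
  have eX : ∫ p in strip B, vx p.1 p.2 ^ 2
      = weightedInner B b (fun x y => pd 1 0 0 u x y t + b * u x y t)
          (fun x y => pd 1 0 0 u x y t + b * u x y t) := by
    simpa only [sq] using inner_eq (fun x y => pd 1 0 0 u x y t + b * u x y t)
      (fun x y => pd 1 0 0 u x y t + b * u x y t)
  have eY : ∫ p in strip B, vy p.1 p.2 ^ 2
      = weightedInner B b (fun x y => pd 0 1 0 u x y t) (fun x y => pd 0 1 0 u x y t) := by
    simpa only [sq] using inner_eq (fun x y => pd 0 1 0 u x y t) (fun x y => pd 0 1 0 u x y t)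
  have hP := poincare_strip hB.le cv cvy dvy v0 vB ivv iyy
  obtain ⟨i4, hQ⟩ := ladyzhenskaya_strip cv cvy dvx dvy v0 vB
    (fun y hy => (hlim y hy).mono_left le_sup_left)
    (fun y hy => (hlim y hy).mono_left le_sup_right) (integ w0 ws) (integ w0 wy)
  have hA := sq_integral_mul_le (μ := volume.restrict (strip B)) (f := fun p => |v p.1 p.2|)
    (g := fun p => |vx p.1 p.2|) (by simpa only [sq_abs, IntegrableOn] using ivv)
    (by simpa only [sq_abs, IntegrableOn] using ixx) (by simp only [← abs_mul]; exact (integ w0 ws).abs)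
  have hC := sq_integral_mul_le (μ := volume.restrict (strip B)) (f := fun p => |v p.1 p.2|)
    (g := fun p => |vy p.1 p.2|) (by simpa only [sq_abs, IntegrableOn] using ivv)
    (by simpa only [sq_abs, IntegrableOn] using iyy) (by simp only [← abs_mul]; exact (integ w0 wy).abs)
  simp only [sq_abs, ← abs_mul] at hA hC
  have eU : ∫ p in strip B, u p.1 p.2 t ^ 2
      = weightedInner B 0 (fun x y => u x y t) (fun x y => u x y t) := by
    simp [weightedInner, sq]
  have eN : ∀ p : ℝ × ℝ, u p.1 p.2 t * v p.1 p.2 ^ 2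
      = Real.exp (2*b*p.1) * (u p.1 p.2 t * (u p.1 p.2 t * u p.1 p.2 t)) := fun p => by
    simp only [v, hE]
    ring
  have hN := sq_integral_mul_le (μ := volume.restrict (strip B)) (f := fun p => u p.1 p.2 t)
    (g := fun p => v p.1 p.2 ^ 2)
    (by simpa [sq, IntegrableOn] using w0.integrableOn_exp_mul (a := 0) le_rfl hb.le w0) i4
    (by simpa only [eN, IntegrableOn] using w0.integrableOn_exp_mul hb.le le_rfl (w0.mul w0))
  rw [eU] at hN
  simp only [eN] at hN
  rw [eV, eY] at hP
  rw [eV, eX] at hA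
  rw [eV, eY] at hC
  have key := energy_arith hB hb (weightedInner_self_nonneg B b _)
    (weightedInner_self_nonneg B b _) (weightedInner_self_nonneg B b _)
    (weightedInner_self_nonneg B 0 _) hbL hP hA hC hQ hN hU
  rw [hu.energy_identity hB hb.le le_rfl ht]
  simp only [weightedInner] at key ⊢
  linarith

end Solution

/-- **Exponential decay of small solutions in the weighted L² norm**
(Theorem 4.1 of the paper). Fix `B > 0` and set
`b* = (1/5)(−1 + √(1 + 5π²/(4B²)))`. For `0 < b ≤ b*`, a classical solution `u`
with decay weight `b` of the ZKB problem on the strip `S` with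
`‖u₀‖ ≤ 3π/(8B)` satisfies, with `χ = bπ²/(4B²)`, for every `t ≥ 0`:
`∫_S e^{2bx} u(t)² ≤ e^{−χt} ∫_S e^{2bx} u₀²`. -/
theorem zkb_exponential_decay (B b : ℝ) (hB : 0 < B) (hb : 0 < b)
    (hbstar : b ≤ (1/5) * (-1 + Real.sqrt (1 + 5*π^2/(4*B^2))))
    (u : ℝ → ℝ → ℝ → ℝ) (hu : IsZKBSolution B b u)
    (hsmall : Real.sqrt (∫ p in strip B, (u p.1 p.2 0)^2) ≤ 3*π/(8*B)) :
    ∀ t : ℝ, 0 ≤ t →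
      (∫ p in strip B, Real.exp (2*b*p.1) * (u p.1 p.2 t)^2)
        ≤ Real.exp (-(b*π^2/(4*B^2))*t)
            * ∫ p in strip B, Real.exp (2*b*p.1) * (u p.1 p.2 0)^2 := by
  intro t ht
  have hbL := quadratic_le_of_le_bstar hb hbstar
  have hU0 : weightedInner B 0 (fun x y => u x y 0) (fun x y => u x y 0)
      ≤ (3 * π / (8 * B)) ^ 2 := by
    have e : weightedInner B 0 (fun x y => u x y 0) (fun x y => u x y 0)
        = ∫ p in strip B, (u p.1 p.2 0)^2 := by
      simp [weightedInner, sq]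
    rw [e]
    exact (Real.sqrt_le_left (by positivity)).1 hsmall
  have key := hu.exp_mul_weightedInner_le hb.le le_rfl (b * π ^ 2 / (4 * B ^ 2)) ht
    fun s hs => hu.weighted_energy_decay hB hb hbL hs.1
      ((hu.weightedInner_zero_le hB hb.le hs.1.le).trans hU0)
  simp only [weightedInner, ← sq] at key
  rw [neg_mul, Real.exp_neg, inv_mul_eq_div, le_div_iff₀ (Real.exp_pos _), mul_comm]
  exact key
end

section
/- Fix B > 0 and b > 0. If u₁ and u₂ are both classical solutions with decay weight b of the Zakharov–Kuznetsov–Burgers problem on the strip S and u₁(x,y,0) = u₂(x,y,0) for all (x,y) ∈ ℝ × [0,B], then u₁(x,y,t) = u₂(x,y,t) for all (x,y,t) ∈ ℝ × [0,B] × [0,∞). -/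
open MeasureTheory Real Set

open scoped ContDiff

/-- The derivative of `f` in the fixed direction `e`. -/
noncomputable def dirDeriv (e : ℝ × ℝ × ℝ) (f : ℝ × ℝ × ℝ → ℝ) (p : ℝ × ℝ × ℝ) : ℝ :=
  fderiv ℝ f p e

/-- Partial derivative in the first variable. -/
noncomputable abbrev dx : (ℝ × ℝ × ℝ → ℝ) → ℝ × ℝ × ℝ → ℝ := dirDeriv (1, 0, 0)

/-- Partial derivative in the second variable. -/
noncomputable abbrev dy : (ℝ × ℝ × ℝ → ℝ) → ℝ × ℝ × ℝ → ℝ := dirDeriv (0, 1, 0)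

/-- Partial derivative in the third variable. -/
noncomputable abbrev dt : (ℝ × ℝ × ℝ → ℝ) → ℝ × ℝ × ℝ → ℝ := dirDeriv (0, 0, 1)

section dirDeriv

variable {f g : ℝ × ℝ × ℝ → ℝ} {e e' p : ℝ × ℝ × ℝ}

theorem ContDiff.dirDeriv (hf : ContDiff ℝ ∞ f) (e : ℝ × ℝ × ℝ) : ContDiff ℝ ∞ (dirDeriv e f) :=
  (hf.fderiv_right (by simp)).clm_apply contDiff_const

theorem ContDiff.iterate_dirDeriv (hf : ContDiff ℝ ∞ f) (e : ℝ × ℝ × ℝ) (n : ℕ) :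
    ContDiff ℝ ∞ ((_root_.dirDeriv e)^[n] f) := by
  induction n generalizing f with
  | zero => exact hf
  | succ n ih => exact ih (hf.dirDeriv e)

theorem dirDeriv_comm (hf : ContDiff ℝ ∞ f) :
    dirDeriv e (dirDeriv e' f) p = dirDeriv e' (dirDeriv e f) p := by
  have hd : DifferentiableAt ℝ (fderiv ℝ f) p :=
    (hf.fderiv_right (m := 1) (by norm_cast)).differentiable (by simp) p
  have key (a b : ℝ × ℝ × ℝ) :
      dirDeriv a (dirDeriv b f) p = fderiv ℝ (fderiv ℝ f) p a b := by
    have h := (hd.hasFDerivAt.clm_apply (hasFDerivAt_const b p)).fderiv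
    change fderiv ℝ (fun q => fderiv ℝ f q b) p a = _
    rw [h]
    simp
  rw [key, key]
  exact hf.contDiffAt.isSymmSndFDerivAt
    (by simpa using mod_cast ENat.LEInfty.out) e e'

theorem dirDeriv_sub (hf : ContDiff ℝ ∞ f) (hg : ContDiff ℝ ∞ g) :
    dirDeriv e (fun q => f q - g q) p = dirDeriv e f p - dirDeriv e g p := by
  simp [dirDeriv, fderiv_fun_sub (hf.differentiable (by simp) p)
    (hg.differentiable (by simp) p)]

theorem dirDeriv_add (hf : ContDiff ℝ ∞ f) (hg : ContDiff ℝ ∞ g) :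
    dirDeriv e (fun q => f q + g q) p = dirDeriv e f p + dirDeriv e g p := by
  simp [dirDeriv, fderiv_fun_add (hf.differentiable (by simp) p)
    (hg.differentiable (by simp) p)]

theorem dirDeriv_mul (hf : ContDiff ℝ ∞ f) (hg : ContDiff ℝ ∞ g) :
    dirDeriv e (fun q => f q * g q) p = dirDeriv e f p * g p + f p * dirDeriv e g p := by
  simp [dirDeriv, fderiv_fun_mul (hf.differentiable (by simp) p)
    (hg.differentiable (by simp) p)]
  ring

theorem hasDerivAt_comp_dirDeriv (hf : ContDiff ℝ ∞ f) {γ : ℝ → ℝ × ℝ × ℝ} {s : ℝ}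
    (hγ : HasDerivAt γ e s) : HasDerivAt (fun r => f (γ r)) (dirDeriv e f (γ s)) s :=
  (hf.differentiable (by simp) _).hasFDerivAt.comp_hasDerivAt s hγ

theorem iteratedDeriv_comp_eq_iterate_dirDeriv (hf : ContDiff ℝ ∞ f) {γ : ℝ → ℝ × ℝ × ℝ}
    (hγ : ∀ s, HasDerivAt γ e s) (n : ℕ) :
    iteratedDeriv n (fun s => f (γ s)) = fun s => (dirDeriv e)^[n] f (γ s) := by
  induction n generalizing f with
  | zero => simp
  | succ n ih =>
    rw [iteratedDeriv_succ']
    have : deriv (fun s => f (γ s)) = fun s => dirDeriv e f (γ s) :=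
      funext fun s => (hasDerivAt_comp_dirDeriv hf (hγ s)).deriv
    rw [this, ih (hf.dirDeriv e)]
    rfl

end dirDeriv

theorem hasDerivAt_line_x (x y t : ℝ) :
    HasDerivAt (fun s : ℝ => ((s, y, t) : ℝ × ℝ × ℝ)) (1, 0, 0) x :=
  (hasDerivAt_id x).prodMk (hasDerivAt_const x (y, t))

theorem hasDerivAt_line_y (x y t : ℝ) :
    HasDerivAt (fun s : ℝ => ((x, s, t) : ℝ × ℝ × ℝ)) (0, 1, 0) y :=
  (hasDerivAt_const y x).prodMk ((hasDerivAt_id y).prodMk (hasDerivAt_const y t))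

theorem hasDerivAt_line_t (x y t : ℝ) :
    HasDerivAt (fun s : ℝ => ((x, y, s) : ℝ × ℝ × ℝ)) (0, 0, 1) t :=
  (hasDerivAt_const t x).prodMk ((hasDerivAt_const t y).prodMk (hasDerivAt_id t))

theorem pd_eq_iterate {u : ℝ → ℝ → ℝ → ℝ} {f : ℝ × ℝ × ℝ → ℝ} (hf : ContDiff ℝ ∞ f)
    (hu : ∀ x y t, u x y t = f (x, y, t)) (i j k : ℕ) (x y t : ℝ) :
    pd i j k u x y t = dx^[i] (dy^[j] (dt^[k] f)) (x, y, t) := by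
  have ht (x y : ℝ) : iteratedDeriv k (u x y) = fun t => dt^[k] f (x, y, t) := by
    rw [show u x y = fun s => f (x, y, s) from funext (hu x y)]
    exact iteratedDeriv_comp_eq_iterate_dirDeriv hf (hasDerivAt_line_t x y) k
  have hy (x : ℝ) : iteratedDeriv j (fun y => dt^[k] f (x, y, t))
      = fun y => dy^[j] (dt^[k] f) (x, y, t) :=
    iteratedDeriv_comp_eq_iterate_dirDeriv (hf.iterate_dirDeriv _ k)
      (fun y => hasDerivAt_line_y x y t) j
  simp only [pd, ht, hy]
  rw [iteratedDeriv_comp_eq_iterate_dirDeriv ((hf.iterate_dirDeriv _ k).iterate_dirDeriv _ j)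
      (fun x => hasDerivAt_line_x x y t) i]

theorem hasDerivAt_intervalIntegral_of_continuous {F F' : ℝ → ℝ → ℝ}
    (hF : Continuous (Function.uncurry F)) (hF' : Continuous (Function.uncurry F'))
    (hd : ∀ t s, HasDerivAt (fun r => F r s) (F' t s) t) (a b t : ℝ) :
    HasDerivAt (fun r => ∫ s in a..b, F r s) (∫ s in a..b, F' t s) t := by
  obtain ⟨C, hC⟩ := ((isCompact_Icc (a := t - 1) (b := t + 1)).prod
    (isCompact_uIcc (a := a) (b := b))).exists_bound_of_continuousOn hF'.continuousOn
  have hFc (r : ℝ) : Continuous (F r) := hF.comp (by fun_prop : Continuous fun s => (r, s))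
  have hFc' (r : ℝ) : Continuous (F' r) := hF'.comp (by fun_prop : Continuous fun s => (r, s))
  refine (intervalIntegral.hasDerivAt_integral_of_dominated_loc_of_deriv_le
    (bound := fun _ => C) (Icc_mem_nhds (by linarith) (by linarith) : Icc (t - 1) (t + 1) ∈ _)
    (.of_forall fun r => (hFc r).aestronglyMeasurable)
    ((hFc t).intervalIntegrable _ _) (hFc' t).aestronglyMeasurable
    (.of_forall fun s hs r hr => hC (r, s) ⟨hr, uIoc_subset_uIcc hs⟩)
    intervalIntegrable_const (.of_forall fun s _ r _ => hd r s)).2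

theorem hasDerivAt_integral_rectangle {g : ℝ × ℝ × ℝ → ℝ} (hg : ContDiff ℝ ∞ g) (a b c d t : ℝ) :
    HasDerivAt (fun r => ∫ y in c..d, ∫ x in a..b, g (x, y, r))
      (∫ y in c..d, ∫ x in a..b, dt g (x, y, t)) t := by
  have hc := hg.continuous
  have hc' := (hg.dirDeriv (0, 0, 1)).continuous
  refine hasDerivAt_intervalIntegral_of_continuous
    (F := fun r y => ∫ x in a..b, g (x, y, r)) (F' := fun r y => ∫ x in a..b, dt g (x, y, r))
    ?_ ?_ (fun r y => ?_) c d t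
  · exact intervalIntegral.continuous_parametric_intervalIntegral_of_continuous'
      (f := fun (q : ℝ × ℝ) x => g (x, q.2, q.1)) (by fun_prop) a b
  · exact intervalIntegral.continuous_parametric_intervalIntegral_of_continuous'
      (f := fun (q : ℝ × ℝ) x => dt g (x, q.2, q.1)) (by fun_prop) a b
  · exact hasDerivAt_intervalIntegral_of_continuous
      (F := fun r x => g (x, y, r)) (F' := fun r x => dt g (x, y, r)) (by fun_prop) (by fun_prop)
      (fun t x => hasDerivAt_comp_dirDeriv hg (hasDerivAt_line_t x y t)) a b r

theorem integral_dx {f : ℝ × ℝ × ℝ → ℝ} (hf : ContDiff ℝ ∞ f) (a b y t : ℝ) :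
    ∫ x in a..b, dx f (x, y, t) = f (b, y, t) - f (a, y, t) := by
  have hc := (hf.dirDeriv (1, 0, 0)).continuous
  exact intervalIntegral.integral_eq_sub_of_hasDerivAt (f := fun x => f (x, y, t))
    (fun x _ => hasDerivAt_comp_dirDeriv hf (hasDerivAt_line_x x y t))
    (Continuous.intervalIntegrable (by fun_prop) _ _)

theorem integral_integral_dy_eq_zero {f : ℝ × ℝ × ℝ → ℝ} (hf : ContDiff ℝ ∞ f) (a b c d t : ℝ)
    (hc : ∀ x, f (x, c, t) = 0) (hd : ∀ x, f (x, d, t) = 0) :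
    ∫ y in c..d, ∫ x in a..b, dy f (x, y, t) = 0 := by
  have hcont := (hf.dirDeriv (0, 1, 0)).continuous
  have hcf : Continuous (Function.uncurry fun y x => dy f (x, y, t)) := by
    simp only [Function.uncurry_def]; fun_prop
  rw [intervalIntegral_intervalIntegral_swap]
  · refine intervalIntegral.integral_zero_ae (.of_forall fun x _ => ?_)
    rw [intervalIntegral.integral_eq_sub_of_hasDerivAt (f := fun y => f (x, y, t))
      (fun y _ => hasDerivAt_comp_dirDeriv hf (hasDerivAt_line_y x y t))
      (Continuous.intervalIntegrable (by fun_prop) _ _), hc, hd, sub_zero]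
  · exact (hcf.continuousOn.integrableOn_compact
      (isCompact_uIcc.prod isCompact_uIcc)).mono_set (prod_mono uIoc_subset_uIcc uIoc_subset_uIcc)

/-- Local energy estimate: if a density `g` vanishing at time `0` satisfies
`∂ₜ g ≤ ∂ₓ F - ∂ᵧ G + K g` where the flux `G` vanishes on the horizontal sides and `|F| ≤ c` on
the vertical sides of the rectangle `[-R, R] × [0, B]`, its integral stays of order `c`. -/
theorem integral_density_le {g F G : ℝ × ℝ × ℝ → ℝ} (hg : ContDiff ℝ ∞ g) (hF : ContDiff ℝ ∞ F)
    (hG : ContDiff ℝ ∞ G) {B R T K c : ℝ} (hB : 0 < B) (hR : 0 ≤ R) (hT : 0 ≤ T) (hK : 0 ≤ K)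
    (hc : 0 ≤ c)
    (hg0 : ∀ x, ∀ y ∈ Icc 0 B, g (x, y, 0) = 0)
    (hineq : ∀ x, ∀ y ∈ Ioo 0 B, ∀ t ∈ Ioo 0 T,
      dt g (x, y, t) ≤ dx F (x, y, t) - dy G (x, y, t) + K * g (x, y, t))
    (hG0 : ∀ x, ∀ t ∈ Ioo 0 T, G (x, 0, t) = 0) (hGB : ∀ x, ∀ t ∈ Ioo 0 T, G (x, B, t) = 0)
    (hFc : ∀ x, R ≤ |x| → ∀ y ∈ Icc 0 B, ∀ t ∈ Icc 0 T, |F (x, y, t)| ≤ c) :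
    ∫ y in (0)..B, ∫ x in (-R)..R, g (x, y, T) ≤ exp (K * T) * (2 * c * B * T) := by
  set E : ℝ → ℝ := fun t => ∫ y in (0)..B, ∫ x in (-R)..R, g (x, y, t) with hE
  have hgc := hg.continuous
  have hgtc := (hg.dirDeriv (0, 0, 1)).continuous
  have hFxc := (hF.dirDeriv (1, 0, 0)).continuous
  have hGyc := (hG.dirDeriv (0, 1, 0)).continuous
  have hEd (t : ℝ) := hasDerivAt_integral_rectangle hg (-R) R 0 B t
  have hint {h : ℝ × ℝ × ℝ → ℝ} (hh : Continuous h) (t : ℝ) :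
      Continuous fun y => ∫ x in (-R)..R, h (x, y, t) :=
    intervalIntegral.continuous_parametric_intervalIntegral_of_continuous'
      (f := fun y x => h (x, y, t)) (by fun_prop) _ _
  have hE' : ∀ t ∈ Ioo 0 T, (∫ y in (0)..B, ∫ x in (-R)..R, dt g (x, y, t))
      ≤ 2 * c * B + K * E t := by
    intro t ht
    have hslice : ∀ y ∈ Ioo 0 B, ∫ x in (-R)..R, dt g (x, y, t)
        ≤ 2 * c - (∫ x in (-R)..R, dy G (x, y, t)) + K * ∫ x in (-R)..R, g (x, y, t) := by
      intro y hy
      have h1 : ∫ x in (-R)..R, dt g (x, y, t) ≤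
          ∫ x in (-R)..R, (dx F (x, y, t) - dy G (x, y, t) + K * g (x, y, t)) :=
        intervalIntegral.integral_mono_on (by linarith)
          (Continuous.intervalIntegrable (by fun_prop) _ _)
          (Continuous.intervalIntegrable (by fun_prop) _ _) (fun x _ => hineq x y hy t ht)
      rw [intervalIntegral.integral_add (Continuous.intervalIntegrable (by fun_prop) _ _)
          (Continuous.intervalIntegrable (by fun_prop) _ _),
        intervalIntegral.integral_sub (Continuous.intervalIntegrable (by fun_prop) _ _)
          (Continuous.intervalIntegrable (by fun_prop) _ _),
        intervalIntegral.integral_const_mul, integral_dx hF] at h1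
      have h2 := hFc R (le_abs_self R) y (Ioo_subset_Icc_self hy) t (Ioo_subset_Icc_self ht)
      have h3 := hFc (-R) (by rw [abs_neg]; exact le_abs_self R) y (Ioo_subset_Icc_self hy) t
        (Ioo_subset_Icc_self ht)
      linarith [(abs_le.1 h2).2, (abs_le.1 h3).1]
    have i1 := hint hgtc t
    have i2 := hint hGyc t
    have i3 := hint hgc t
    have h1 := intervalIntegral.integral_mono_on_of_le_Ioo hB.le
      (i1.intervalIntegrable (μ := volume) _ _)
      (Continuous.intervalIntegrable (by fun_prop) _ _) hslice
    rw [intervalIntegral.integral_add (Continuous.intervalIntegrable (by fun_prop) _ _)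
        (Continuous.intervalIntegrable (by fun_prop) _ _),
      intervalIntegral.integral_sub (Continuous.intervalIntegrable (by fun_prop) _ _)
        (Continuous.intervalIntegrable (by fun_prop) _ _),
      intervalIntegral.integral_const, intervalIntegral.integral_const_mul,
      integral_integral_dy_eq_zero hG _ _ _ _ _ (fun x => hG0 x t ht) (fun x => hGB x t ht)] at h1
    simp only [sub_zero, smul_eq_mul] at h1
    simp only [hE]
    linarith
  have hφ (t : ℝ) : HasDerivAt (fun t => exp (-K * t) * E t - 2 * c * B * t)
      (exp (-K * t) * ((∫ y in (0)..B, ∫ x in (-R)..R, dt g (x, y, t)) - K * E t)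
        - 2 * c * B) t := by
    have h1 : HasDerivAt (fun t => exp (-K * t)) (exp (-K * t) * (-K)) t := by
      simpa using ((hasDerivAt_id t).const_mul (-K)).exp
    refine ((h1.mul (hEd t)).sub ((hasDerivAt_id t).const_mul (2 * c * B))).congr_deriv ?_
    simp only [hE]
    ring
  have hanti : AntitoneOn (fun t => exp (-K * t) * E t - 2 * c * B * t) (Icc 0 T) := by
    refine antitoneOn_of_deriv_nonpos (convex_Icc 0 T)
      (fun t _ => (hφ t).continuousAt.continuousWithinAt)
      (fun t _ => (hφ t).differentiableAt.differentiableWithinAt) fun t ht => ?_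
    rw [interior_Icc] at ht
    rw [(hφ t).deriv]
    have hle : exp (-K * t) ≤ 1 := exp_le_one_iff.2 (by nlinarith [ht.1])
    have hcB : 0 ≤ 2 * c * B := by positivity
    nlinarith [mul_le_mul_of_nonneg_left (sub_le_iff_le_add.2 (hE' t ht)) (exp_pos (-K * t)).le]
  have hE0 : E 0 = 0 := by
    refine intervalIntegral.integral_zero_ae (.of_forall fun y hy => ?_)
    rw [uIoc_of_le hB.le] at hy
    simp [hg0 _ y (Ioc_subset_Icc_self hy)]
  have hfin := hanti ⟨le_rfl, hT⟩ ⟨hT, le_rfl⟩ hT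
  simp only [hE0, mul_zero, sub_zero] at hfin
  have hexp : exp (K * T) * exp (-K * T) = 1 := by rw [← exp_add]; simp
  calc E T = exp (K * T) * (exp (-K * T) * E T) := by rw [← mul_assoc, hexp, one_mul]
    _ ≤ exp (K * T) * (2 * c * B * T) :=
      mul_le_mul_of_nonneg_left (by linarith) (exp_pos _).le

theorem eq_zero_of_integral_rectangle_nonpos {g : ℝ × ℝ × ℝ → ℝ} (hg : Continuous g)
    (hg0 : ∀ p, 0 ≤ g p) {a b c d t : ℝ} (hab : a < b) (hcd : c < d)
    (h : ∫ y in c..d, ∫ x in a..b, g (x, y, t) ≤ 0) {x y : ℝ} (hx : x ∈ Icc a b)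
    (hy : y ∈ Icc c d) : g (x, y, t) = 0 := by
  by_contra hne
  have hpos : 0 < g (x, y, t) := lt_of_le_of_ne (hg0 _) (Ne.symm hne)
  refine h.not_gt (intervalIntegral.integral_pos hcd (Continuous.continuousOn ?_)
    (fun y _ => intervalIntegral.integral_nonneg hab.le fun x _ => hg0 _) ⟨y, hy, ?_⟩)
  · exact intervalIntegral.continuous_parametric_intervalIntegral_of_continuous'
      (f := fun y x => g (x, y, t)) (by fun_prop) _ _
  · exact intervalIntegral.integral_pos hab (Continuous.continuousOn (by fun_prop))
      (fun x _ => hg0 _) ⟨x, hx, hpos⟩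

/-- The function of one variable in `ℝ × ℝ × ℝ` attached to a function of three variables. -/
def joint (u : ℝ → ℝ → ℝ → ℝ) (p : ℝ × ℝ × ℝ) : ℝ := u p.1 p.2.1 p.2.2

namespace IsZKBSolution

variable {B b : ℝ} {u : ℝ → ℝ → ℝ → ℝ}

theorem smooth_joint (h : IsZKBSolution B b u) : ContDiff ℝ ∞ (joint u) := h.smooth

theorem pde_joint (h : IsZKBSolution B b u) (x : ℝ) {y t : ℝ} (hy : y ∈ Ioo 0 B) (ht : 0 < t) :
    dt (joint u) (x, y, t) - dx (dx (joint u)) (x, y, t)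
      + joint u (x, y, t) * dx (joint u) (x, y, t) + dx (dx (dx (joint u))) (x, y, t)
      + dx (dy (dy (joint u))) (x, y, t) = 0 := by
  have hp := h.pde x y hy t ht
  simp only [pd_eq_iterate (u := u) h.smooth_joint fun _ _ _ => rfl] at hp
  exact hp

theorem eventually_abs_le (h : IsZKBSolution B b u) (i j k : ℕ) (hijk : i + j + k ≤ 5) (T : ℝ)
    {δ : ℝ} (hδ : 0 < δ) : ∀ᶠ R in Filter.atTop, ∀ x : ℝ, R ≤ |x| → ∀ y ∈ Icc 0 B, ∀ t ∈ Icc 0 T,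
      |dx^[i] (dy^[j] (dt^[k] (joint u))) (x, y, t)| ≤ δ := by
  obtain ⟨R, hR⟩ := h.decay i j k hijk T (δ ^ 2) (by positivity)
  filter_upwards [Filter.eventually_ge_atTop R] with R' hR' x hx y hy t ht
  have hd := hR x (hR'.trans hx) y hy t ht
  rw [pd_eq_iterate (u := u) h.smooth_joint fun _ _ _ => rfl] at hd
  refine abs_le_of_sq_le_sq ?_ hδ.le
  nlinarith [mul_nonneg (exp_pos (2 * b * x)).le
    (sq_nonneg (dx^[i] (dy^[j] (dt^[k] (joint u))) (x, y, t)))]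

theorem exists_abs_dx_le (h : IsZKBSolution B b u) (T : ℝ) :
    ∃ K, 0 ≤ K ∧ ∀ x, ∀ y ∈ Icc 0 B, ∀ t ∈ Icc 0 T, |dx (joint u) (x, y, t)| ≤ K := by
  obtain ⟨R, hR⟩ := (h.eventually_abs_le 1 0 0 (by norm_num) T one_pos).exists
  obtain ⟨C, hC⟩ := ((isCompact_Icc (a := -R) (b := R)).prod
    ((isCompact_Icc (a := 0) (b := B)).prod
      (isCompact_Icc (a := 0) (b := T)))).exists_bound_of_continuousOn
    (h.smooth_joint.dirDeriv (1, 0, 0)).continuous.continuousOn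
  refine ⟨max 1 C, by positivity, fun x y hy t ht => ?_⟩
  rcases le_total R |x| with hx | hx
  · exact (hR x hx y hy t ht).trans (le_max_left _ _)
  · exact (hC (x, y, t) ⟨abs_le.1 hx, hy, ht⟩).trans (le_max_right _ _)

end IsZKBSolution

/-- The horizontal energy flux of the difference `w` of two solutions, the first being `f`. -/
noncomputable def fluxX (f w : ℝ × ℝ × ℝ → ℝ) (q : ℝ × ℝ × ℝ) : ℝ :=
  (w q * dx w q + w q * dx w q) - f q * (w q * w q) - (w q * dx (dx w) q + w q * dx (dx w) q)
    + dx w q * dx w q + dy w q * dy w q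

/-- The vertical energy flux of the difference `w` of two solutions. -/
noncomputable def fluxY (w : ℝ × ℝ × ℝ → ℝ) (q : ℝ × ℝ × ℝ) : ℝ :=
  w q * dx (dy w) q + w q * dx (dy w) q

section flux

variable {f w : ℝ × ℝ × ℝ → ℝ}

theorem smooth_fluxX (hf : ContDiff ℝ ∞ f) (hw : ContDiff ℝ ∞ w) : ContDiff ℝ ∞ (fluxX f w) := by
  have h1 := hw.dirDeriv (1, 0, 0)
  have h2 := h1.dirDeriv (1, 0, 0)
  have h3 := hw.dirDeriv (0, 1, 0)
  unfold fluxX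
  fun_prop

theorem smooth_fluxY (hw : ContDiff ℝ ∞ w) : ContDiff ℝ ∞ (fluxY w) := by
  have h1 := (hw.dirDeriv (0, 1, 0)).dirDeriv (1, 0, 0)
  unfold fluxY
  fun_prop

theorem dx_fluxX (hf : ContDiff ℝ ∞ f) (hw : ContDiff ℝ ∞ w) (q : ℝ × ℝ × ℝ) :
    dx (fluxX f w) q = 2 * w q * dx (dx w) q + 2 * (dx w q) ^ 2 - dx f q * (w q) ^ 2
      - 2 * f q * w q * dx w q - 2 * w q * dx (dx (dx w)) q + 2 * dy w q * dx (dy w) q := by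
  have h1 := hw.dirDeriv (1, 0, 0)
  have h2 := h1.dirDeriv (1, 0, 0)
  have h3 := hw.dirDeriv (0, 1, 0)
  unfold fluxX
  rw [dx, dirDeriv_add (by fun_prop) (by fun_prop), dirDeriv_add (by fun_prop) (by fun_prop),
    dirDeriv_sub (by fun_prop) (by fun_prop), dirDeriv_sub (by fun_prop) (by fun_prop),
    dirDeriv_add (by fun_prop) (by fun_prop), dirDeriv_add (by fun_prop) (by fun_prop),
    dirDeriv_mul hw h1, dirDeriv_mul hf (by fun_prop), dirDeriv_mul hw hw,
    dirDeriv_mul hw h2, dirDeriv_mul h1 h1, dirDeriv_mul h3 h3]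
  ring

theorem dy_fluxY (hw : ContDiff ℝ ∞ w) (q : ℝ × ℝ × ℝ) :
    dy (fluxY w) q = 2 * dy w q * dx (dy w) q + 2 * w q * dx (dy (dy w)) q := by
  have h3 := hw.dirDeriv (0, 1, 0)
  have h1 := h3.dirDeriv (1, 0, 0)
  unfold fluxY
  rw [dy, dirDeriv_add (by fun_prop) (by fun_prop), dirDeriv_mul hw h1, dirDeriv_comm h3]
  ring

theorem abs_fluxX_le {δ : ℝ} {q : ℝ × ℝ × ℝ} (hδ : δ ≤ 1) (hf : |f q| ≤ 1) (hw : |w q| ≤ δ)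
    (hx : |dx w q| ≤ δ) (hxx : |dx (dx w) q| ≤ δ) (hy : |dy w q| ≤ δ) :
    |fluxX f w q| ≤ 7 * δ := by
  have hδ0 : 0 ≤ δ := (abs_nonneg _).trans hw
  have key {a c : ℝ} (ha : |a| ≤ δ) (hc : |c| ≤ δ) : |a * c| ≤ δ := by
    rw [abs_mul]
    nlinarith [abs_nonneg a, abs_nonneg c]
  have h1 := abs_le.1 (key hw hx)
  have h2 := abs_le.1 (key hw hxx)
  have h3 := abs_le.1 (key hx hx)
  have h4 := abs_le.1 (key hy hy)
  have h5 : |f q * (w q * w q)| ≤ δ := by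
    rw [abs_mul]
    nlinarith [key hw hw, abs_nonneg (f q), abs_nonneg (w q * w q)]
  have h6 := abs_le.1 h5
  unfold fluxX
  rw [abs_le]
  constructor <;> linarith [h1.1, h1.2, h2.1, h2.2, h3.1, h3.2, h4.1, h4.2, h6.1, h6.2]

end flux

/-- Energy balance for the difference of two solutions of the Zakharov–Kuznetsov–Burgers
equation. -/
theorem IsZKBSolution.energy_balance {B b : ℝ} {u₁ u₂ : ℝ → ℝ → ℝ → ℝ}
    (h₁ : IsZKBSolution B b u₁) (h₂ : IsZKBSolution B b u₂) {w : ℝ × ℝ × ℝ → ℝ}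
    (hw : w = fun q => joint u₁ q - joint u₂ q) (x : ℝ) {y t : ℝ} (hy : y ∈ Ioo 0 B)
    (ht : 0 < t) :
    dt (fun q => w q * w q) (x, y, t)
      = dx (fluxX (joint u₁) w) (x, y, t) - dy (fluxY w) (x, y, t) - 2 * (dx w (x, y, t)) ^ 2
        + (dx (joint u₁) (x, y, t) - 2 * dx (joint u₂) (x, y, t)) * (w (x, y, t)) ^ 2 := by
  have s₁ := h₁.smooth_joint
  have s₂ := h₂.smooth_joint
  have hws : ContDiff ℝ ∞ w := by rw [hw]; fun_prop
  have hd {f g v : ℝ × ℝ × ℝ → ℝ} (hv : v = fun q => f q - g q) (hf : ContDiff ℝ ∞ f) (hg : ContDiff ℝ ∞ g)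
      (e : ℝ × ℝ × ℝ) : dirDeriv e v = fun q => dirDeriv e f q - dirDeriv e g q := by
    subst hv
    exact funext fun _ => dirDeriv_sub hf hg
  have ex := hd hw s₁ s₂ (1, 0, 0)
  have exx := hd ex (s₁.dirDeriv _) (s₂.dirDeriv _) (1, 0, 0)
  have exxx := hd exx ((s₁.dirDeriv _).dirDeriv _) ((s₂.dirDeriv _).dirDeriv _) (1, 0, 0)
  have ey := hd hw s₁ s₂ (0, 1, 0)
  have eyy := hd ey (s₁.dirDeriv _) (s₂.dirDeriv _) (0, 1, 0)
  have exyy := hd eyy ((s₁.dirDeriv _).dirDeriv _) ((s₂.dirDeriv _).dirDeriv _) (1, 0, 0)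
  have et := hd hw s₁ s₂ (0, 0, 1)
  have p₁ := h₁.pde_joint x hy ht
  have p₂ := h₂.pde_joint x hy ht
  rw [dx_fluxX s₁ hws, dy_fluxY hws, dt, dirDeriv_mul hws hws]
  have vw := congrFun hw (x, y, t)
  have vx := congrFun ex (x, y, t)
  have vxx := congrFun exx (x, y, t)
  have vxxx := congrFun exxx (x, y, t)
  have vxyy := congrFun exyy (x, y, t)
  have vt := congrFun et (x, y, t)
  linear_combination (2 * w (x, y, t)) * (p₁ - p₂ + vt - vxx + joint u₁ (x, y, t) * vx + vxxx + vxyy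
    + dx (joint u₂) (x, y, t) * vw)

/-- **Uniqueness of regular solutions** (Theorem 3.4 of the paper, stated for
classical solutions): two classical solutions with decay weight `b` of the ZKB
problem on the strip `S` with the same initial data coincide on
`ℝ × [0,B] × [0,∞)`. -/
theorem zkb_uniqueness (B b : ℝ) (hB : 0 < B) (hb : 0 < b)
    (u₁ u₂ : ℝ → ℝ → ℝ → ℝ)
    (h₁ : IsZKBSolution B b u₁) (h₂ : IsZKBSolution B b u₂)
    (h0 : ∀ x : ℝ, ∀ y ∈ Set.Icc (0:ℝ) B, u₁ x y 0 = u₂ x y 0) :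
    ∀ x : ℝ, ∀ y ∈ Set.Icc (0:ℝ) B, ∀ t : ℝ, 0 ≤ t → u₁ x y t = u₂ x y t := by
  intro x₀ y₀ hy₀ T hT
  obtain ⟨w, hw⟩ : ∃ w : ℝ × ℝ × ℝ → ℝ, w = fun q => joint u₁ q - joint u₂ q := ⟨_, rfl⟩
  have s₁ := h₁.smooth_joint
  have s₂ := h₂.smooth_joint
  have hws : ContDiff ℝ ∞ w := by rw [hw]; fun_prop
  have hw2 : ContDiff ℝ ∞ fun q => w q * w q := by fun_prop
  have hwu (x y t : ℝ) : w (x, y, t) = u₁ x y t - u₂ x y t := by rw [hw]; rfl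
  have hbdry {y : ℝ} (hy : ∀ x t : ℝ, 0 ≤ t → w (x, y, t) = 0) :
      ∀ x, ∀ t ∈ Ioo 0 T, fluxY w (x, y, t) = 0 := fun x t ht => by
    simp [fluxY, hy x t ht.1.le]
  obtain ⟨K₁, hK₁, hb₁⟩ := h₁.exists_abs_dx_le T
  obtain ⟨K₂, hK₂, hb₂⟩ := h₂.exists_abs_dx_le T
  set K := K₁ + 2 * K₂
  set R₀ := |x₀| + 1
  have hR₀pos : 0 < R₀ := by positivity
  set E := ∫ y in (0)..B, ∫ x in (-R₀)..R₀, w (x, y, T) * w (x, y, T)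
  have hbound : ∀ δ : ℝ, 0 < δ → δ ≤ 1 → E ≤ exp (K * T) * (2 * (7 * δ) * B * T) := by
    intro δ hδ hδ1
    have hδ2 : 0 < δ / 2 := by positivity
    obtain ⟨R, hR, hf, a₀, a₁, a₂, a₃, b₀, b₁, b₂, b₃⟩ :=
      ((Filter.eventually_ge_atTop R₀).and
      ((h₁.eventually_abs_le 0 0 0 (by norm_num) T one_pos).and
      ((h₁.eventually_abs_le 0 0 0 (by norm_num) T hδ2).and
      ((h₁.eventually_abs_le 1 0 0 (by norm_num) T hδ2).and
      ((h₁.eventually_abs_le 2 0 0 (by norm_num) T hδ2).and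
      ((h₁.eventually_abs_le 0 1 0 (by norm_num) T hδ2).and
      ((h₂.eventually_abs_le 0 0 0 (by norm_num) T hδ2).and
      ((h₂.eventually_abs_le 1 0 0 (by norm_num) T hδ2).and
      ((h₂.eventually_abs_le 2 0 0 (by norm_num) T hδ2).and
      (h₂.eventually_abs_le 0 1 0 (by norm_num) T hδ2)))))))))).exists
    have hsub {a c : ℝ} (ha : |a| ≤ δ / 2) (hc : |c| ≤ δ / 2) : |a - c| ≤ δ := by
      linarith [abs_sub a c]
    have hmono : E ≤ ∫ y in (0)..B, ∫ x in (-R)..R, w (x, y, T) * w (x, y, T) := by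
      have hc := hws.continuous
      have hint (r : ℝ) : Continuous fun y => ∫ x in (-r)..r, w (x, y, T) * w (x, y, T) :=
        intervalIntegral.continuous_parametric_intervalIntegral_of_continuous'
          (f := fun y x => w (x, y, T) * w (x, y, T)) (by fun_prop) _ _
      refine intervalIntegral.integral_mono_on hB.le ((hint R₀).intervalIntegrable _ _)
        ((hint R).intervalIntegrable _ _) fun y _ => ?_
      exact intervalIntegral.integral_mono_interval (by linarith) (by linarith) hR
        (.of_forall fun x => mul_self_nonneg _) (Continuous.intervalIntegrable (by fun_prop) _ _)
    refine hmono.trans (integral_density_le hw2 (smooth_fluxX s₁ hws) (smooth_fluxY hws) hB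
      (by linarith) hT (by positivity) (by positivity) ?_ ?_ (hbdry ?_) (hbdry ?_) ?_)
    · intro x y hy
      simp [hwu, h0 x y hy]
    · intro x y hy t ht
      rw [h₁.energy_balance h₂ hw x hy ht.1]
      have hy' := Ioo_subset_Icc_self hy
      have ht' := Ioo_subset_Icc_self ht
      have hk : dx (joint u₁) (x, y, t) - 2 * dx (joint u₂) (x, y, t) ≤ K := by
        linarith [(abs_le.1 (hb₁ x y hy' t ht')).2, (abs_le.1 (hb₂ x y hy' t ht')).1]
      nlinarith [mul_le_mul_of_nonneg_right hk (sq_nonneg (w (x, y, t))),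
        sq_nonneg (dx w (x, y, t))]
    · intro x t ht
      simp [hwu, h₁.bdry0 x t ht, h₂.bdry0 x t ht]
    · intro x t ht
      simp [hwu, h₁.bdryB x t ht, h₂.bdryB x t ht]
    · intro x hx y hy t ht
      have ex : dx w = fun q => dx (joint u₁) q - dx (joint u₂) q := by
        rw [hw]; exact funext fun _ => dirDeriv_sub s₁ s₂
      refine abs_fluxX_le hδ1 (hf x hx y hy t ht) ?_ ?_ ?_ ?_
      · rw [hw]
        exact hsub (a₀ x hx y hy t ht) (b₀ x hx y hy t ht)
      · rw [ex]
        exact hsub (a₁ x hx y hy t ht) (b₁ x hx y hy t ht)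
      · rw [ex, dx, dirDeriv_sub (s₁.dirDeriv _) (s₂.dirDeriv _)]
        exact hsub (a₂ x hx y hy t ht) (b₂ x hx y hy t ht)
      · rw [hw, dy, dirDeriv_sub s₁ s₂]
        exact hsub (a₃ x hx y hy t ht) (b₃ x hx y hy t ht)
  have hE0 : E ≤ 0 := by
    have hlim : Filter.Tendsto (fun δ : ℝ => exp (K * T) * (2 * (7 * δ) * B * T))
        (nhdsWithin 0 (Ioi 0)) (nhds 0) := by
      have : Continuous fun δ : ℝ => exp (K * T) * (2 * (7 * δ) * B * T) := by fun_prop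
      simpa using (this.tendsto 0).mono_left nhdsWithin_le_nhds
    refine ge_of_tendsto hlim ?_
    filter_upwards [Ioc_mem_nhdsGT one_pos] with δ hδ using hbound δ hδ.1 hδ.2
  have hzero := eq_zero_of_integral_rectangle_nonpos hw2.continuous
    (fun q => mul_self_nonneg (w q)) (by linarith) hB hE0
    (x := x₀) (y := y₀) (abs_le.1 (by linarith)) hy₀
  have := mul_self_eq_zero.1 hzero
  rw [hwu] at this
  linarith
end
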